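/- arXiv:2107.02796 — 2 statements merged into one kernel-verified Lean document; each statement's English description precedes it below -/
import Mathlib

section
/- If G is a maximal outerplanar graph on n ≥ 3 vertices with t vertices of degree 2, then γ×2(G) ≤ ⌊(n+t)/2⌋. -/
open SimpleGraph

/-- `S` is a double dominating set of `G`: every vertex has at least two
vertices of its closed neighborhood in `S`. -/
def IsDoubleDomSet {V : Type*} [Fintype V] [DecidableEq V]
    (G : SimpleGraph V) [DecidableRel G.Adj] (S : Finset V) : Prop :=
  ∀ v : V, 2 ≤ (S ∩ insert v (G.neighborFinset v)).card

/-- The double domination number `γ×2(G)`. -/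
noncomputable def doubleDomNum {V : Type*} [Fintype V] [DecidableEq V]
    (G : SimpleGraph V) [DecidableRel G.Adj] : ℕ :=
  sInf {k | ∃ S : Finset V, IsDoubleDomSet G S ∧ S.card = k}

/-- `H` is a minor of `G`. -/
def HasMinor {V W : Type*} (G : SimpleGraph V) (H : SimpleGraph W) : Prop :=
  ∃ f : W → Set V,
    (∀ w, (f w).Nonempty) ∧
    (∀ w, (G.induce (f w)).Connected) ∧
    (Pairwise fun w₁ w₂ => Disjoint (f w₁) (f w₂)) ∧
    ∀ ⦃w₁ w₂⦄, H.Adj w₁ w₂ → ∃ a ∈ f w₁, ∃ b ∈ f w₂, G.Adj a b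

/-- A graph is outerplanar iff it has no `K₄` minor and no `K_{2,3}` minor. -/
def Outerplanar {V : Type*} (G : SimpleGraph V) : Prop :=
  ¬ HasMinor G (⊤ : SimpleGraph (Fin 4)) ∧
  ¬ HasMinor G (completeBipartiteGraph (Fin 2) (Fin 3))

/-- Maximal outerplanar: outerplanar, and adding any missing edge destroys
outerplanarity. -/
def MaximalOuterplanar {V : Type*} (G : SimpleGraph V) : Prop :=
  Outerplanar G ∧
  ∀ u v : V, u ≠ v → ¬ G.Adj u v →
    ¬ Outerplanar (G ⊔ SimpleGraph.fromEdgeSet {s(u, v)})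

/-- `T` is an internal triangle of `G`: a triangle none of whose edges lies
on any Hamiltonian cycle (for a maximal outerplanar graph on `≥ 4` vertices
the Hamiltonian cycle, i.e. the boundary of the outer face, is unique). -/
def IsInternalTriangle {V : Type*} [DecidableEq V] (G : SimpleGraph V) (T : Finset V) : Prop :=
  ∃ a b c : V, T = {a, b, c} ∧ a ≠ b ∧ a ≠ c ∧ b ≠ c ∧
    G.Adj a b ∧ G.Adj a c ∧ G.Adj b c ∧
    ∀ ⦃v : V⦄ (p : G.Walk v v), p.IsHamiltonianCycle →
      s(a, b) ∉ p.edges ∧ s(a, c) ∉ p.edges ∧ s(b, c) ∉ p.edges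

/-- `IsTwoTreeOn G s`: the induced subgraph of `G` on `s` is a 2-tree,
built from a triangle by repeatedly adding a vertex joined exactly to the
two endpoints of an existing edge. -/
inductive IsTwoTreeOn {V : Type*} [DecidableEq V] (G : SimpleGraph V) :
    Finset V → Prop
  | triangle {a b c : V} : a ≠ b → a ≠ c → b ≠ c →
      G.Adj a b → G.Adj a c → G.Adj b c → IsTwoTreeOn G {a, b, c}
  | grow {s : Finset V} {x y v : V} : IsTwoTreeOn G s → x ∈ s → y ∈ s →
      G.Adj x y → v ∉ s → (∀ u ∈ s, G.Adj v u ↔ u = x ∨ u = y) →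
      IsTwoTreeOn G (insert v s)

/-- `G` is a 2-tree (equivalently, a maximal `K₄`-minor-free graph). -/
def IsTwoTree {V : Type*} [Fintype V] [DecidableEq V] (G : SimpleGraph V) : Prop :=
  IsTwoTreeOn G Finset.univ


namespace MOP

/-- Connected vertex set, via cuts. -/
def Cn {V : Type*} (G : SimpleGraph V) (S : Set V) : Prop :=
  S.Nonempty ∧ ∀ T : Set V, (∃ a ∈ S, a ∈ T) → (∃ b ∈ S, b ∉ T) →
    ∃ a ∈ S, ∃ b ∈ S, a ∈ T ∧ b ∉ T ∧ G.Adj a b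

/-- two sets touch -/
def Tch {V : Type*} (G : SimpleGraph V) (P Q : Set V) : Prop :=
  ∃ a ∈ P, ∃ b ∈ Q, G.Adj a b

/-- disjointness, elementwise -/
def Dj {V : Type*} (P Q : Set V) : Prop := ∀ v, v ∈ P → v ∉ Q

section
variable {V : Type*} {G : SimpleGraph V}

lemma cn_of_connected {S : Set V} (h : (G.induce S).Connected) : Cn G S := by
  refine ⟨Set.nonempty_coe_sort.1 h.nonempty, ?_⟩
  rintro T ⟨a, ha, haT⟩ ⟨b, hb, hbT⟩
  by_contra hcon
  push Not at hcon
  have key : ∀ (u v : S), (G.induce S).Walk u v → (u : V) ∈ T → (v : V) ∈ T := by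
    intro u v w
    induction w with
    | nil => exact fun h => h
    | cons hadj _ ih =>
      intro hu
      apply ih
      by_contra hv
      exact hcon _ (Subtype.prop _) _ (Subtype.prop _) hu hv hadj
  obtain ⟨w⟩ := h.preconnected ⟨a, ha⟩ ⟨b, hb⟩
  exact hbT (key _ _ w haT)

lemma connected_of_cn {S : Set V} (h : Cn G S) : (G.induce S).Connected := by
  have : Nonempty S := h.1.to_subtype
  refine ⟨?_⟩
  intro a b
  by_contra hcon
  obtain ⟨u, hu, v, hv, ⟨hu', hr⟩, hvT, hadj⟩ :=
    h.2 {v | ∃ hv : v ∈ S, (G.induce S).Reachable a ⟨v, hv⟩}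
    ⟨a, a.2, a.2, SimpleGraph.Reachable.refl _⟩ ⟨b, b.2, fun ⟨_, hr⟩ => hcon hr⟩
  apply hvT
  refine ⟨hv, hr.trans (SimpleGraph.Adj.reachable ?_)⟩
  exact hadj

lemma cn_single (a : V) : Cn G {a} := by
  refine ⟨⟨a, rfl⟩, ?_⟩
  rintro T ⟨b, rfl, hb⟩ ⟨c, rfl, hc⟩
  exact absurd hb hc

lemma Tch.symm {P Q : Set V} (h : Tch G P Q) : Tch G Q P := by
  obtain ⟨a, ha, b, hb, h⟩ := h
  exact ⟨b, hb, a, ha, h.symm⟩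

lemma Tch.mono {P Q P' Q' : Set V} (h : Tch G P Q) (h1 : P ⊆ P') (h2 : Q ⊆ Q') : Tch G P' Q' := by
  obtain ⟨a, ha, b, hb, h⟩ := h
  exact ⟨a, h1 ha, b, h2 hb, h⟩

lemma Dj.symm {P Q : Set V} (h : Dj P Q) : Dj Q P := fun v hv hv' => h v hv' hv

lemma cn_union_tch {P Q : Set V} (hP : Cn G P) (hQ : Cn G Q) (h : Tch G P Q) :
    Cn G (P ∪ Q) := by
  refine ⟨hP.1.mono Set.subset_union_left, ?_⟩
  rintro T ⟨a, ha, haT⟩ ⟨b, hb, hbT⟩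
  by_cases h1 : (∃ a ∈ P, a ∈ T) ∧ (∃ b ∈ P, b ∉ T)
  · obtain ⟨a, ha, b, hb, h⟩ := hP.2 T h1.1 h1.2
    exact ⟨a, Or.inl ha, b, Or.inl hb, h⟩
  by_cases h2 : (∃ a ∈ Q, a ∈ T) ∧ (∃ b ∈ Q, b ∉ T)
  · obtain ⟨a, ha, b, hb, h⟩ := hQ.2 T h2.1 h2.2
    exact ⟨a, Or.inr ha, b, Or.inr hb, h⟩
  obtain ⟨p, hp, q, hq, hpq⟩ := h
  have := hpq.symm
  by_cases hpT : p ∈ T <;> by_cases hqT : q ∈ T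
  · grind
  · exact ⟨p, Or.inl hp, q, Or.inr hq, hpT, hqT, hpq⟩
  · exact ⟨q, Or.inr hq, p, Or.inl hp, hqT, hpT, this⟩
  · grind

lemma cn_union_meet {P Q : Set V} (hP : Cn G P) (hQ : Cn G Q) {v : V} (h1 : v ∈ P) (h2 : v ∈ Q) :
    Cn G (P ∪ Q) := by
  refine ⟨hP.1.mono Set.subset_union_left, ?_⟩
  rintro T ⟨a, ha, haT⟩ ⟨b, hb, hbT⟩
  by_cases h1 : (∃ a ∈ P, a ∈ T) ∧ (∃ b ∈ P, b ∉ T)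
  · obtain ⟨a, ha, b, hb, h⟩ := hP.2 T h1.1 h1.2
    exact ⟨a, Or.inl ha, b, Or.inl hb, h⟩
  by_cases h2 : (∃ a ∈ Q, a ∈ T) ∧ (∃ b ∈ Q, b ∉ T)
  · obtain ⟨a, ha, b, hb, h⟩ := hQ.2 T h2.1 h2.2
    exact ⟨a, Or.inr ha, b, Or.inr hb, h⟩
  grind

/-- The component of `D` in `U \ R` touches `R`. -/
lemma compTouch {U D R : Set V} (hU : Cn G U) (hD : Cn G D) (hDU : D ⊆ U) (hDR : Dj D R)
    (hR : ∃ r ∈ U, r ∈ R) : ∃ E, Cn G E ∧ D ⊆ E ∧ E ⊆ U ∧ Dj E R ∧ Tch G E (R ∩ U) := by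
  obtain ⟨d, hd⟩ := hD.1
  obtain ⟨a, ha, b, hb, ⟨E, hE, hDE, hEU, hER, haE⟩, hbT, hab⟩ :=
    hU.2 {v | ∃ E, Cn G E ∧ D ⊆ E ∧ E ⊆ U ∧ Dj E R ∧ v ∈ E}
      ⟨d, hDU hd, D, hD, subset_rfl, hDU, hDR, hd⟩
      (by
        obtain ⟨r, hrU, hrR⟩ := hR
        exact ⟨r, hrU, fun ⟨E, _, _, _, hER, hrE⟩ => hER r hrE hrR⟩)
  refine ⟨E, hE, hDE, hEU, hER, a, haE, b, ⟨?_, hb⟩, hab⟩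
  by_contra hbR
  apply hbT
  refine ⟨E ∪ {b}, cn_union_tch hE (cn_single b) ⟨a, haE, b, rfl, hab⟩,
    hDE.trans Set.subset_union_left, ?_, ?_, Or.inr rfl⟩
  · rintro v (hv | rfl)
    · exact hEU hv
    · exact hb
  · rintro v (hv | rfl)
    · exact hER v hv
    · exact hbR

/-- `D` is a connector from `A` to `B` in `C`. -/
def Ctr (G : SimpleGraph V) (C A B D : Set V) : Prop :=
  D ⊆ C ∧ Cn G D ∧ (∃ a ∈ D, a ∈ A) ∧ (∃ b ∈ D, b ∈ B)

lemma menger [Finite V] (n : ℕ) : ∀ C A B : Set V, C.ncard = n →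
    (∀ D₁ D₂, Ctr G C A B D₁ → Ctr G C A B D₂ → Dj D₁ D₂ → False) →
    (∀ D, ¬ Ctr G C A B D) ∨ ∃ z ∈ C, ∀ D, Ctr G C A B D → z ∈ D := by
  induction n with
  | zero =>
    intro C A B hC _
    left
    rintro D ⟨h1, h2, ⟨a, ha, _⟩, _⟩
    rw [Set.ncard_eq_zero] at hC
    have := h1 ha
    simp [hC] at this
  | succ n ih =>
    intro C A B hC hno
    by_cases hA : ∃ a ∈ C, a ∈ A
    swap
    · left
      rintro D ⟨h1, h2, ⟨a, ha, haA⟩, _⟩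
      exact hA ⟨a, h1 ha, haA⟩
    obtain ⟨a, haC, haA⟩ := hA
    by_cases haB : a ∈ B
    · right
      refine ⟨a, haC, fun D hD => ?_⟩
      by_contra haD
      refine hno {a} D ⟨by simpa using haC, cn_single a, ⟨a, rfl, haA⟩, ⟨a, rfl, haB⟩⟩ hD ?_
      rintro v rfl
      exact haD
    by_cases hK : ∀ D, Ctr G C A B D → a ∈ D
    · exact Or.inr ⟨a, haC, hK⟩
    push Not at hK
    obtain ⟨K, ⟨hKC, hK, ⟨a₂, ha₂K, ha₂A⟩, ⟨b, hbK, hbB⟩⟩, haK⟩ := hK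
    -- helper : extending by `a`
    have ext : ∀ D, Cn G D → D ⊆ C → Tch G {a} D → (∃ b ∈ D, b ∈ B) →
        Ctr G C A B ({a} ∪ D) := by
      intro D hD hDC ht ⟨b, hb, hbB⟩
      refine ⟨?_, cn_union_tch (cn_single a) hD ht, ⟨a, Or.inl rfl, haA⟩, ⟨b, Or.inr hb, hbB⟩⟩
      rintro v (rfl | hv)
      · exact haC
      · exact hDC hv
    -- helper asymmetrical
    have asym : ∀ D₁ D₂, D₁ ⊆ C → D₂ ⊆ C → a ∉ D₁ → Dj D₁ D₂ → Cn G D₁ → Cn G D₂ →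
        (∃ v ∈ D₁, v ∈ A) → (∃ b ∈ D₁, b ∈ B) → (∃ b ∈ D₂, b ∈ B) → Tch G {a} D₂ → False := by
      intro D₁ D₂ h1 h2 ha1 hd c1 c2 hA1 hB1 hB2 ht
      refine hno D₁ ({a} ∪ D₂) ⟨h1, c1, hA1, hB1⟩ (ext D₂ c2 h2 ht hB2) ?_
      rintro v hv (rfl | hv2)
      · exact ha1 hv
      · exact hd v hv hv2
    have hsub : C \ {a} ⊆ C := Set.sdiff_subset
    rcases ih (C \ {a}) (A ∪ {v | G.Adj a v}) B (by
        rw [Set.ncard_sdiff_singleton_of_mem haC, hC]; rfl) (by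
      rintro D₁ D₂ ⟨h1, c1, ⟨u₁, hu1, hu1'⟩, hB1⟩ ⟨h2, c2, ⟨u₂, hu2, hu2'⟩, hB2⟩ hd
      have ha1 : a ∉ D₁ := fun h => (h1 h).2 rfl
      have ha2 : a ∉ D₂ := fun h => (h2 h).2 rfl
      by_cases hA1 : ∃ v ∈ D₁, v ∈ A
      · by_cases hA2 : ∃ v ∈ D₂, v ∈ A
        · exact hno D₁ D₂ ⟨h1.trans hsub, c1, hA1, hB1⟩ ⟨h2.trans hsub, c2, hA2, hB2⟩ hd
        · refine asym D₁ D₂ (h1.trans hsub) (h2.trans hsub) ha1 hd c1 c2 hA1 hB1 hB2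
            ⟨a, rfl, u₂, hu2, hu2'.resolve_left fun h => hA2 ⟨_, hu2, h⟩⟩
      have t1 : Tch G {a} D₁ := ⟨a, rfl, u₁, hu1, hu1'.resolve_left fun h => hA1 ⟨_, hu1, h⟩⟩
      by_cases hA2 : ∃ v ∈ D₂, v ∈ A
      · exact asym D₂ D₁ (h2.trans hsub) (h1.trans hsub) ha2 hd.symm c2 c1 hA2 hB2 hB1 t1
      have t2 : Tch G {a} D₂ := ⟨a, rfl, u₂, hu2, hu2'.resolve_left fun h => hA2 ⟨_, hu2, h⟩⟩
      by_cases hmeet : ∃ r ∈ K, r ∈ D₁ ∪ D₂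
      swap
      · exact asym K D₁ hKC (h1.trans hsub) haK (fun v hv hv' => hmeet ⟨v, hv, Or.inl hv'⟩)
          hK c1 ⟨a₂, ha₂K, ha₂A⟩ ⟨b, hbK, hbB⟩ hB1 t1
      obtain ⟨E, cE, haE, hEK, hER, e, he, r, ⟨hr, hrK⟩, her⟩ := compTouch hK (cn_single a₂)
        (by simpa using ha₂K) (R := D₁ ∪ D₂)
        (by
          rintro v rfl (hv | hv)
          · exact hA1 ⟨_, hv, ha₂A⟩
          · exact hA2 ⟨_, hv, ha₂A⟩) hmeet
      have hEC := hEK.trans hKC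
      have haE' : a ∉ E := fun h => haK (hEK h)
      rcases hr with hr | hr
      · refine asym (E ∪ D₁) D₂ (Set.union_subset hEC (h1.trans hsub)) (h2.trans hsub)
          (by rintro (h | h) <;> contradiction) ?_ (cn_union_tch cE c1 ⟨e, he, r, hr, her⟩) c2
          ⟨a₂, Or.inl (haE rfl), ha₂A⟩ ?_ hB2 t2
        · rintro v (hv | hv) h
          · exact hER v hv (Or.inr h)
          · exact hd v hv h
        · obtain ⟨b, hb, hb'⟩ := hB1
          exact ⟨b, Or.inr hb, hb'⟩
      · refine asym (E ∪ D₂) D₁ (Set.union_subset hEC (h2.trans hsub)) (h1.trans hsub)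
          (by rintro (h | h) <;> contradiction) ?_ (cn_union_tch cE c2 ⟨e, he, r, hr, her⟩) c1
          ⟨a₂, Or.inl (haE rfl), ha₂A⟩ ?_ hB1 t1
        · rintro v (hv | hv) h
          · exact hER v hv (Or.inl h)
          · exact hd v h hv
        · obtain ⟨b, hb, hb'⟩ := hB2
          exact ⟨b, Or.inr hb, hb'⟩) with hnone | ⟨z, hz, hzD⟩
    · exact absurd ⟨fun v hv => ⟨hKC hv, by rintro rfl; exact haK hv⟩, hK,
        ⟨a₂, ha₂K, Or.inl ha₂A⟩, ⟨b, hbK, hbB⟩⟩ (hnone K)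
    · right
      refine ⟨z, hz.1, ?_⟩
      rintro D ⟨hDC, cD, ⟨u, hu, huA⟩, ⟨w, hw, hwB⟩⟩
      by_cases haD : a ∈ D
      swap
      · exact hzD D ⟨fun v hv => ⟨hDC hv, by rintro rfl; exact haD hv⟩, cD,
          ⟨u, hu, Or.inl huA⟩, ⟨w, hw, hwB⟩⟩
      obtain ⟨E, cE, hwE, hED, hER, e, he, r, ⟨rfl, _⟩, her⟩ := compTouch cD (cn_single w)
        (by simpa using hw) (R := {a}) (by rintro v rfl rfl; exact haB hwB) ⟨a, haD, rfl⟩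
      exact hED (hzD E ⟨fun v hv => ⟨hDC (hED hv), hER v hv⟩, cE, ⟨e, he, Or.inr her.symm⟩,
        ⟨w, hwE rfl, hwB⟩⟩)

end
end MOP

namespace MOP
section
variable {V : Type*} {G : SimpleGraph V}

/-- `f` places the vertices of `S` on a line without crossing edges. -/
def NC (G : SimpleGraph V) (f : V → ℤ) (S : Set V) : Prop :=
  (∀ a ∈ S, ∀ b ∈ S, f a = f b → a = b) ∧
  ∀ a ∈ S, ∀ b ∈ S, ∀ c ∈ S, ∀ d ∈ S, f a < f b → f b < f c → f c < f d →
    G.Adj a c → G.Adj b d → False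

lemma NC.neg {f : V → ℤ} {S : Set V} (h : NC G f S) : NC G (fun v => - f v) S := by
  refine ⟨fun a ha b hb hab => h.1 a ha b hb (by simpa using hab), ?_⟩
  intro a ha b hb c hc d hd h1 h2 h3 hac hbd
  exact h.2 d hd c hc b hb a ha (by simpa using h3) (by simpa using h2) (by simpa using h1)
    hbd.symm hac.symm

lemma cat [Finite V] (f₁ f₂ : V → ℤ) (S : Set V) : ∃ (g : V → ℤ) (M : ℤ),
    (∀ v ∈ S, g v = f₁ v) ∧ (∀ v, v ∉ S → g v = f₂ v + M) ∧
    ∀ v ∈ S, ∀ w, w ∉ S → g v < g w := by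
  classical
  obtain ⟨M₁, h₁⟩ := (Set.finite_range f₁).bddAbove
  obtain ⟨M₂, h₂⟩ := (Set.finite_range f₂).bddBelow
  refine ⟨fun v => if v ∈ S then f₁ v else f₂ v + (M₁ - M₂ + 1), M₁ - M₂ + 1, ?_, ?_, ?_⟩
  · intro v hv; simp [hv]
  · intro v hv; simp [hv]
  · intro v hv w hw
    have := h₁ ⟨v, rfl⟩
    have := h₂ ⟨w, rfl⟩
    simp only [hv, hw, if_true, if_false]
    omega

/-- Placement with `x` first. -/
def OrdT (G : SimpleGraph V) (S : Set V) (x : V) : Prop :=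
  ∃ f, NC G f S ∧ ∀ v ∈ S, f x ≤ f v

/-- Placement with `x` first and `y` last. -/
def OrdS (G : SimpleGraph V) (S : Set V) (x y : V) : Prop :=
  ∃ f, NC G f S ∧ (∀ v ∈ S, f x ≤ f v) ∧ (∀ v ∈ S, f v ≤ f y)

lemma glue_cut [Finite V] {S S₁ S₂ : Set V} {x : V} (h1 : OrdT G S₁ x) (h2 : OrdT G S₂ x)
    (hx1 : x ∈ S₁) (hx2 : x ∈ S₂) (hS : ∀ v, v ∈ S ↔ v ∈ S₁ ∨ v ∈ S₂)
    (hd : ∀ v ∈ S₁, v ∈ S₂ → v = x)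
    (he : ∀ v ∈ S₁, ∀ w ∈ S₂, v ≠ x → w ≠ x → ¬ G.Adj v w) : OrdT G S x := by
  obtain ⟨f₁, n1, x1⟩ := h1
  obtain ⟨f₂, n2, x2⟩ := h2
  obtain ⟨g, M, g1, g2, g3⟩ := cat f₁ f₂ S₁
  have n11 := n1.1
  have n21 := n2.1
  refine ⟨g, ⟨?_, ?_⟩, ?_⟩
  · intro a ha b hb hab
    rw [hS] at ha hb
    by_cases a1 : a ∈ S₁ <;> by_cases b1 : b ∈ S₁ <;> grind
  · intro a ha b hb c hc d hd h1 h2 h3 hac hbd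
    rw [hS] at ha hb hc hd
    by_cases d1 : d ∈ S₁
    · have c1 : c ∈ S₁ := by grind
      have b1 : b ∈ S₁ := by grind
      have a1 : a ∈ S₁ := by grind
      exact n1.2 a a1 b b1 c c1 d d1 (by grind) (by grind) (by grind) hac hbd
    have d2 := hd.resolve_left d1
    have bx : b ∈ S₁ → b = x := fun hb1 => by
      by_contra hbx; exact he b hb1 d d2 hbx (by grind) hbd
    by_cases b1 : b ∈ S₁
    · have := bx b1
      have a1 : a ∈ S₁ := by grind
      grind
    have b2 := hb.resolve_left b1
    have c1 : c ∉ S₁ := by grind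
    have c2 := hc.resolve_left c1
    by_cases a1 : a ∈ S₁
    · have ax : a = x := by
        by_contra hax; exact he a a1 c c2 hax (by grind) hac
      subst ax
      have := x2 b b2
      have : f₂ a ≠ f₂ b := fun h => by
        have := n21 a hx2 b b2 h
        grind
      exact n2.2 a hx2 b b2 c c2 d d2 (by omega) (by grind) (by grind) hac hbd
    · have a2 := ha.resolve_left a1
      exact n2.2 a a2 b b2 c c2 d d2 (by grind) (by grind) (by grind) hac hbd
  · intro v hv
    rw [hS] at hv
    by_cases v1 : v ∈ S₁ <;> grind

lemma glue_disj [Finite V] {S S₁ S₂ : Set V} {x y : V} (h1 : OrdT G S₁ x) (h2 : OrdT G S₂ y)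
    (hx1 : x ∈ S₁) (hy2 : y ∈ S₂) (hS : ∀ v, v ∈ S ↔ v ∈ S₁ ∨ v ∈ S₂)
    (hd : ∀ v ∈ S₁, v ∉ S₂)
    (he : ∀ v ∈ S₁, ∀ w ∈ S₂, G.Adj v w → v = x ∧ w = y) : OrdS G S x y := by
  obtain ⟨f₁, n1, x1⟩ := h1
  obtain ⟨f₂', n2', x2'⟩ := h2
  obtain ⟨f₂, n2, x2⟩ : ∃ f₂, NC G f₂ S₂ ∧ ∀ v ∈ S₂, f₂ v ≤ f₂ y :=
    ⟨fun v => - f₂' v, n2'.neg, fun v hv => by simpa using x2' v hv⟩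
  obtain ⟨g, M, g1, g2, g3⟩ := cat f₁ f₂ S₁
  have n11 := n1.1
  have n21 := n2.1
  refine ⟨g, ⟨?_, ?_⟩, ?_, ?_⟩
  · intro a ha b hb hab
    rw [hS] at ha hb
    by_cases a1 : a ∈ S₁ <;> by_cases b1 : b ∈ S₁ <;> grind
  · intro a ha b hb c hc d hd h1 h2 h3 hac hbd
    rw [hS] at ha hb hc hd
    by_cases d1 : d ∈ S₁
    · have c1 : c ∈ S₁ := by grind
      have b1 : b ∈ S₁ := by grind
      have a1 : a ∈ S₁ := by grind
      exact n1.2 a a1 b b1 c c1 d d1 (by grind) (by grind) (by grind) hac hbd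
    have d2 := hd.resolve_left d1
    by_cases b1 : b ∈ S₁
    · have := he b b1 d d2 hbd
      have a1 : a ∈ S₁ := by grind
      grind
    have b2 := hb.resolve_left b1
    have c1 : c ∉ S₁ := by grind
    have c2 := hc.resolve_left c1
    by_cases a1 : a ∈ S₁
    · have := he a a1 c c2 hac
      grind
    · have a2 := ha.resolve_left a1
      exact n2.2 a a2 b b2 c c2 d d2 (by grind) (by grind) (by grind) hac hbd
  · intro v hv
    rw [hS] at hv
    by_cases v1 : v ∈ S₁ <;> grind
  · intro v hv
    rw [hS] at hv
    by_cases v1 : v ∈ S₁ <;> grind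

lemma glue_z [Finite V] {S S₁ S₂ : Set V} {x y z : V} (h1 : OrdS G S₁ x z) (h2 : OrdS G S₂ z y)
    (hx1 : x ∈ S₁) (hy2 : y ∈ S₂) (hz1 : z ∈ S₁) (hz2 : z ∈ S₂) (hyz : y ≠ z)
    (hS : ∀ v, v ∈ S ↔ v ∈ S₁ ∨ v ∈ S₂)
    (hd : ∀ v ∈ S₁, v ∈ S₂ → v = z)
    (he : ∀ v ∈ S₁, ∀ w ∈ S₂, v ≠ z → w ≠ z → G.Adj v w → v = x ∧ w = y) : OrdS G S x y := by
  obtain ⟨f₁, n1, x1, z1⟩ := h1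
  obtain ⟨f₂, n2, z2, y2⟩ := h2
  obtain ⟨g, M, g1, g2, g3⟩ := cat f₁ f₂ S₁
  have n11 := n1.1
  have n21 := n2.1
  refine ⟨g, ⟨?_, ?_⟩, ?_, ?_⟩
  · intro a ha b hb hab
    rw [hS] at ha hb
    by_cases a1 : a ∈ S₁ <;> by_cases b1 : b ∈ S₁ <;> grind
  · intro a ha b hb c hc d hd h1 h2 h3 hac hbd
    rw [hS] at ha hb hc hd
    by_cases d1 : d ∈ S₁
    · have c1 : c ∈ S₁ := by grind
      have b1 : b ∈ S₁ := by grind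
      have a1 : a ∈ S₁ := by grind
      exact n1.2 a a1 b b1 c c1 d d1 (by grind) (by grind) (by grind) hac hbd
    have d2 := hd.resolve_left d1
    have dz : d ≠ z := by grind
    by_cases b1 : b ∈ S₁
    · have a1 : a ∈ S₁ := by grind
      have bx : b ≠ x := by grind
      have bz : b = z := by
        by_contra hbz; exact bx (he b b1 d d2 hbz dz hbd).1
      have az : a ≠ z := by grind
      have c1 : c ∉ S₁ := by grind
      have c2 := hc.resolve_left c1
      have := he a a1 c c2 az (by grind) hac
      grind
    have b2 := hb.resolve_left b1
    have c1 : c ∉ S₁ := by grind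
    have c2 := hc.resolve_left c1
    have cz : c ≠ z := by grind
    have cy : c ≠ y := by grind
    by_cases a1 : a ∈ S₁
    · have az : a = z := by
        by_contra haz; exact cy (he a a1 c c2 haz cz hac).2
      subst az
      have := z2 b b2
      have : f₂ a ≠ f₂ b := fun h => by
        have := n21 a hz2 b b2 h
        grind
      exact n2.2 a hz2 b b2 c c2 d d2 (by omega) (by grind) (by grind) hac hbd
    · have a2 := ha.resolve_left a1
      exact n2.2 a a2 b b2 c c2 d d2 (by grind) (by grind) (by grind) hac hbd
  · intro v hv
    rw [hS] at hv
    by_cases v1 : v ∈ S₁ <;> grind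
  · intro v hv
    rw [hS] at hv
    by_cases v1 : v ∈ S₁ <;> grind

/-- no `K₄` minor, set form -/
def NoK4 (G : SimpleGraph V) : Prop :=
  ∀ A B C D : Set V, Cn G A → Cn G B → Cn G C → Cn G D →
    Dj A B → Dj A C → Dj A D → Dj B C → Dj B D → Dj C D →
    Tch G A B → Tch G A C → Tch G A D → Tch G B C → Tch G B D → Tch G C D → False

/-- no `K_{2,3}` minor, set form -/
def NoK23 (G : SimpleGraph V) : Prop :=
  ∀ P Q A B C : Set V, Cn G P → Cn G Q → Cn G A → Cn G B → Cn G C →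
    Dj P Q → Dj P A → Dj P B → Dj P C → Dj Q A → Dj Q B → Dj Q C → Dj A B → Dj A C → Dj B C →
    Tch G P A → Tch G P B → Tch G P C → Tch G Q A → Tch G Q B → Tch G Q C → False

lemma disjoint_of_dj {P Q : Set V} (h : Dj P Q) : Disjoint P Q :=
  Set.disjoint_left.2 fun {v} => h v

lemma dj_of_disjoint {P Q : Set V} (h : Disjoint P Q) : Dj P Q :=
  fun _ => fun hv => Set.disjoint_left.1 h hv

lemma noK4_of (h : ¬ HasMinor G (⊤ : SimpleGraph (Fin 4))) : NoK4 G := by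
  intro A B C D cA cB cC cD dAB dAC dAD dBC dBD dCD tAB tAC tAD tBC tBD tCD
  apply h
  refine ⟨![A, B, C, D], ?_, ?_, ?_, ?_⟩
  · intro w; fin_cases w
    exacts [cA.1, cB.1, cC.1, cD.1]
  · intro w; fin_cases w
    exacts [connected_of_cn cA, connected_of_cn cB, connected_of_cn cC, connected_of_cn cD]
  · intro i j hij
    apply disjoint_of_dj
    fin_cases i <;> fin_cases j <;> first | exact absurd rfl hij | skip
    exacts [dAB, dAC, dAD, dAB.symm, dBC, dBD, dAC.symm, dBC.symm, dCD, dAD.symm, dBD.symm,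
      dCD.symm]
  · intro i j hij
    change Tch G _ _
    have hij : i ≠ j := hij
    fin_cases i <;> fin_cases j <;> first | exact absurd rfl hij | skip
    exacts [tAB, tAC, tAD, tAB.symm, tBC, tBD, tAC.symm, tBC.symm, tCD, tAD.symm, tBD.symm,
      tCD.symm]

lemma noK23_of (h : ¬ HasMinor G (completeBipartiteGraph (Fin 2) (Fin 3))) : NoK23 G := by
  intro P Q A B C cP cQ cA cB cC dPQ dPA dPB dPC dQA dQB dQC dAB dAC dBC tPA tPB tPC tQA tQB tQC
  apply h
  refine ⟨Sum.elim ![P, Q] ![A, B, C], ?_, ?_, ?_, ?_⟩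
  · rintro (w | w) <;> fin_cases w
    exacts [cP.1, cQ.1, cA.1, cB.1, cC.1]
  · rintro (w | w) <;> fin_cases w
    exacts [connected_of_cn cP, connected_of_cn cQ, connected_of_cn cA, connected_of_cn cB,
      connected_of_cn cC]
  · intro i j hij
    apply disjoint_of_dj
    rcases i with i | i <;> rcases j with j | j <;> fin_cases i <;> fin_cases j <;>
      first | exact absurd rfl hij | skip
    exacts [dPQ, dPQ.symm, dPA, dPB, dPC, dQA, dQB, dQC, dPA.symm, dQA.symm, dPB.symm, dQB.symm,
      dPC.symm, dQC.symm, dAB, dAC, dAB.symm, dBC, dAC.symm, dBC.symm]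
  · intro i j hij
    change Tch G _ _
    rcases i with i | i <;> rcases j with j | j
    · simp at hij
    · fin_cases i <;> fin_cases j
      exacts [tPA, tPB, tPC, tQA, tQB, tQC]
    · fin_cases i <;> fin_cases j
      exacts [tPA.symm, tQA.symm, tPB.symm, tQB.symm, tPC.symm, tQC.symm]
    · simp at hij

/-- disjoint connected sets do not interleave -/
lemma no_interleave {f : V → ℤ} (hf : NC G f Set.univ) {P Q : Set V} (hP : Cn G P) (hQ : Cn G Q)
    (hd : Dj P Q) {a b c d : V} (ha : a ∈ P) (hc : c ∈ P) (hb : b ∈ Q) (hdQ : d ∈ Q)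
    (h1 : f a < f b) (h2 : f b < f c) (h3 : f c < f d) : False := by
  have inj : ∀ u v, u ≠ v → f u ≠ f v := fun u v huv h => huv (hf.1 u trivial v trivial h)
  have nc : ∀ a b c d, f a < f b → f b < f c → f c < f d → G.Adj a c → G.Adj b d → False :=
    fun a b c d => hf.2 a trivial b trivial c trivial d trivial
  have pq : ∀ p ∈ P, ∀ q ∈ Q, f p ≠ f q := fun p hp q hq => inj p q (by
    rintro rfl; exact hd _ hp hq)
  obtain ⟨p, hp, q, hq, hpT, hqT, hpq⟩ := hP.2 {v | f b < f v ∧ f v < f d} ⟨c, hc, h2, h3⟩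
    ⟨a, ha, fun h => by have := h.1; omega⟩
  simp only [Set.mem_ofPred_eq, not_and, not_lt] at hpT hqT
  have qb := pq q hq b hb
  have qd := pq q hq d hdQ
  rcases lt_or_gt_of_ne qb with hqb | hqb
  · obtain ⟨r, hr, s, hs, hrT, hsT, hrs⟩ := hQ.2 {v | f q < f v ∧ f v < f p} ⟨b, hb, hqb, hpT.1⟩
      ⟨d, hdQ, fun h => by have := h.2; omega⟩
    simp only [Set.mem_ofPred_eq, not_and, not_lt] at hrT hsT
    have s1 := pq q hq s hs
    have s2 := pq p hp s hs
    by_cases hs' : f s < f q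
    · exact nc s q r p hs' hrT.1 hrT.2 hrs.symm hpq.symm
    · exact nc q r p s hrT.1 hrT.2 (by have := hsT (by omega); omega) hpq.symm hrs
  · have hdq : f d < f q := by have := hqT hqb; omega
    obtain ⟨r, hr, s, hs, hrT, hsT, hrs⟩ := hQ.2 {v | f p < f v ∧ f v < f q} ⟨d, hdQ, hpT.2, hdq⟩
      ⟨b, hb, fun h => by have := h.1; omega⟩
    simp only [Set.mem_ofPred_eq, not_and, not_lt] at hrT hsT
    have s1 := pq q hq s hs
    have s2 := pq p hp s hs
    by_cases hs' : f s < f p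
    · exact nc s p r q hs' hrT.1 hrT.2 hrs.symm hpq
    · exact nc p r q s hrT.1 hrT.2 (by have := hsT (by omega); omega) hpq hrs

/-- cyclic separation -/
def Sep (f : V → ℤ) (a c b d : V) : Prop :=
  (f a < f b ∧ f b < f c ∧ (f c < f d ∨ f d < f a)) ∨
  (f c < f b ∧ f b < f a ∧ (f a < f d ∨ f d < f c)) ∨
  (f a < f d ∧ f d < f c ∧ (f c < f b ∨ f b < f a)) ∨
  (f c < f d ∧ f d < f a ∧ (f a < f b ∨ f b < f c))

lemma no_sep {f : V → ℤ} (hf : NC G f Set.univ) {P Q : Set V} (hP : Cn G P) (hQ : Cn G Q)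
    (hd : Dj P Q) {a b c d : V} (ha : a ∈ P) (hc : c ∈ P) (hb : b ∈ Q) (hdQ : d ∈ Q)
    (h : Sep f a c b d) : False := by
  rcases h with ⟨h1, h2, h3 | h3⟩ | ⟨h1, h2, h3 | h3⟩ | ⟨h1, h2, h3 | h3⟩ | ⟨h1, h2, h3 | h3⟩
  · exact no_interleave hf hP hQ hd ha hc hb hdQ h1 h2 h3
  · exact no_interleave hf hQ hP hd.symm hdQ hb ha hc h3 h1 h2
  · exact no_interleave hf hP hQ hd hc ha hb hdQ h1 h2 h3
  · exact no_interleave hf hQ hP hd.symm hdQ hb hc ha h3 h1 h2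
  · exact no_interleave hf hP hQ hd ha hc hdQ hb h1 h2 h3
  · exact no_interleave hf hQ hP hd.symm hb hdQ ha hc h3 h1 h2
  · exact no_interleave hf hP hQ hd hc ha hdQ hb h1 h2 h3
  · exact no_interleave hf hQ hP hd.symm hb hdQ hc ha h3 h1 h2

lemma Dj.union {P Q R S : Set V} (h1 : Dj P R) (h2 : Dj P S) (h3 : Dj Q R) (h4 : Dj Q S) :
    Dj (P ∪ Q) (R ∪ S) := by
  rintro v (hv | hv) (hw | hw)
  exacts [h1 v hv hw, h2 v hv hw, h3 v hv hw, h4 v hv hw]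

lemma outerplanar_of_nc {f : V → ℤ} (hf : NC G f Set.univ) : Outerplanar G := by
  have inj : ∀ u v, u ≠ v → f u ≠ f v := fun u v huv h => huv (hf.1 u trivial v trivial h)
  constructor
  · rintro ⟨F, hne, hc, hd, ht⟩
    have cn : ∀ i, Cn G (F i) := fun i => cn_of_connected (hc i)
    have dj : ∀ i j, i ≠ j → Dj (F i) (F j) := fun i j hij => dj_of_disjoint (hd hij)
    have tc : ∀ i j, i ≠ j → Tch G (F i) (F j) := fun i j hij => ht hij
    choose r hr using hne
    have rne : ∀ i j, i ≠ j → f (r i) ≠ f (r j) := fun i j hij => inj _ _ (by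
      intro h; exact dj i j hij _ (hr i) (h ▸ hr j))
    have key : ∀ i j k l : Fin 4, i ≠ j → i ≠ k → i ≠ l → j ≠ k → j ≠ l → k ≠ l →
        ¬ Sep f (r i) (r j) (r k) (r l) := by
      intro i j k l ij ik il jk jl kl hs
      exact no_sep hf (cn_union_tch (cn i) (cn j) (tc i j ij))
        (cn_union_tch (cn k) (cn l) (tc k l kl))
        (Dj.union (dj i k ik) (dj i l il) (dj j k jk) (dj j l jl))
        (Or.inl (hr i)) (Or.inr (hr j)) (Or.inl (hr k)) (Or.inr (hr l)) hs
    have k1 := key 0 1 2 3 (by decide) (by decide) (by decide) (by decide) (by decide) (by decide)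
    have k2 := key 0 2 1 3 (by decide) (by decide) (by decide) (by decide) (by decide) (by decide)
    have k3 := key 0 3 1 2 (by decide) (by decide) (by decide) (by decide) (by decide) (by decide)
    have r1 := rne 0 1 (by decide)
    have r2 := rne 0 2 (by decide)
    have r3 := rne 0 3 (by decide)
    have r4 := rne 1 2 (by decide)
    have r5 := rne 1 3 (by decide)
    have r6 := rne 2 3 (by decide)
    unfold Sep at k1 k2 k3
    omega
  · rintro ⟨F, hne, hc, hd, ht⟩
    have cn : ∀ i, Cn G (F i) := fun i => cn_of_connected (hc i)
    have dj : ∀ i j, i ≠ j → Dj (F i) (F j) := fun i j hij => dj_of_disjoint (hd hij)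
    have tc : ∀ i j, Tch G (F (Sum.inl i)) (F (Sum.inr j)) := fun i j => ht (by simp)
    choose r hr using hne
    have rne : ∀ i j, i ≠ j → f (r i) ≠ f (r j) := fun i j hij => inj _ _ (by
      intro h; exact dj i j hij _ (hr i) (h ▸ hr j))
    have key : ∀ (i j : Fin 2) (k l : Fin 3), i ≠ j → k ≠ l →
        ¬ Sep f (r (Sum.inl i)) (r (Sum.inr k)) (r (Sum.inl j)) (r (Sum.inr l)) := by
      intro i j k l ij kl hs
      exact no_sep hf (cn_union_tch (cn _) (cn _) (tc i k)) (cn_union_tch (cn _) (cn _) (tc j l))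
        (Dj.union (dj _ _ (by simpa using ij)) (dj _ _ (by simp)) (dj _ _ (by simp))
          (dj _ _ (by simpa using kl)))
        (Or.inl (hr _)) (Or.inr (hr _)) (Or.inl (hr _)) (Or.inr (hr _)) hs
    have k1 := key 0 1 0 1 (by decide) (by decide)
    have k2 := key 0 1 0 2 (by decide) (by decide)
    have k3 := key 0 1 1 0 (by decide) (by decide)
    have k4 := key 0 1 1 2 (by decide) (by decide)
    have k5 := key 0 1 2 0 (by decide) (by decide)
    have k6 := key 0 1 2 1 (by decide) (by decide)
    have r0 := rne (Sum.inl 0) (Sum.inl 1) (by simp)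
    have r1 := rne (Sum.inl 0) (Sum.inr 0) (by simp)
    have r2 := rne (Sum.inl 0) (Sum.inr 1) (by simp)
    have r3 := rne (Sum.inl 0) (Sum.inr 2) (by simp)
    have r4 := rne (Sum.inl 1) (Sum.inr 0) (by simp)
    have r5 := rne (Sum.inl 1) (Sum.inr 1) (by simp)
    have r6 := rne (Sum.inl 1) (Sum.inr 2) (by simp)
    have r7 := rne (Sum.inr 0) (Sum.inr 1) (by simp)
    have r8 := rne (Sum.inr 0) (Sum.inr 2) (by simp)
    have r9 := rne (Sum.inr 1) (Sum.inr 2) (by simp)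
    unfold Sep at k1 k2 k3 k4 k5 k6
    clear key rne inj
    generalize f (r (Sum.inl 0)) = p at *
    generalize f (r (Sum.inl 1)) = q at *
    generalize f (r (Sum.inr 0)) = a at *
    generalize f (r (Sum.inr 1)) = b at *
    generalize f (r (Sum.inr 2)) = c at *
    rcases lt_or_gt_of_ne r0 with h | h <;> rcases lt_or_gt_of_ne r1 with h1 | h1 <;>
    rcases lt_or_gt_of_ne r2 with h2 | h2 <;> rcases lt_or_gt_of_ne r3 with h3 | h3 <;>
    rcases lt_or_gt_of_ne r4 with h4 | h4 <;> rcases lt_or_gt_of_ne r5 with h5 | h5 <;>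
    rcases lt_or_gt_of_ne r6 with h6 | h6 <;> rcases lt_or_gt_of_ne r7 with h7 | h7 <;>
    rcases lt_or_gt_of_ne r8 with h8 | h8 <;> rcases lt_or_gt_of_ne r9 with h9 | h9 <;>
    omega

end
end MOP

namespace MOP
section
variable {V : Type*} {G : SimpleGraph V}

/-- no two disjoint connected sets join `x` and `y` inside `S`. -/
def S0 (G : SimpleGraph V) (S : Set V) (x y : V) : Prop :=
  ∀ D₁ D₂ : Set V, Ctr G (S \ {x, y}) {v | G.Adj x v} {v | G.Adj y v} D₁ →
    Ctr G (S \ {x, y}) {v | G.Adj x v} {v | G.Adj y v} D₂ → Dj D₁ D₂ → False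

/-- `x`, `y` are linked through `W` outside `S`. -/
def Wk (G : SimpleGraph V) (S : Set V) (x y : V) : Prop :=
  ∃ W, Cn G W ∧ Dj W S ∧ Tch G {x} W ∧ Tch G {y} W

lemma s0_of_wk (h : NoK23 G) {S : Set V} {x y : V} (hx : x ∈ S) (hy : y ∈ S) (hxy : x ≠ y)
    (hW : Wk G S x y) : S0 G S x y := by
  obtain ⟨W, cW, dW, tx, ty⟩ := hW
  rintro D₁ D₂ ⟨h1, c1, ⟨a1, ha1, ha1'⟩, ⟨b1, hb1, hb1'⟩⟩ ⟨h2, c2, ⟨a2, ha2, ha2'⟩, ⟨b2, hb2, hb2'⟩⟩ hd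
  have aux : ∀ (D : Set V) (u : V), D ⊆ S \ {x, y} → (u = x ∨ u = y) → Dj {u} D := by
    rintro D u hD hu v rfl hv
    exact (hD hv).2 hu
  have aux2 : ∀ (D : Set V), D ⊆ S \ {x, y} → Dj D W := by
    intro D hD v hv hvW
    exact dW v hvW (hD hv).1
  refine h {x} {y} D₁ D₂ W (cn_single x) (cn_single y) c1 c2 cW ?_ (aux _ _ h1 (Or.inl rfl))
    (aux _ _ h2 (Or.inl rfl)) ?_ (aux _ _ h1 (Or.inr rfl)) (aux _ _ h2 (Or.inr rfl)) ?_ hd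
    (aux2 _ h1) (aux2 _ h2) ⟨x, rfl, a1, ha1, ha1'⟩ ⟨x, rfl, a2, ha2, ha2'⟩ tx
    ⟨y, rfl, b1, hb1, hb1'⟩ ⟨y, rfl, b2, hb2, hb2'⟩ ty
  · rintro v rfl hv; exact hxy hv
  · rintro v rfl hv; exact dW _ hv hx
  · rintro v rfl hv; exact dW _ hv hy

lemma wk_extend {S S₁ C : Set V} {x y z : V} (hl : G.Adj x y ∨ Wk G S x y)
    (hC : Cn G C) (hyC : y ∈ C) (hz : Tch G {z} C) (hS : S₁ ⊆ S) (hd : Dj C S₁) :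
    Wk G S₁ x z := by
  rcases hl with hl | ⟨W, cW, dW, tx, ty⟩
  · exact ⟨C, hC, hd, ⟨x, rfl, y, hyC, hl⟩, hz⟩
  · refine ⟨C ∪ W, cn_union_tch hC cW (ty.mono (by simpa using hyC) subset_rfl), ?_,
      tx.mono subset_rfl Set.subset_union_right, hz.mono subset_rfl Set.subset_union_left⟩
    rintro v (hv | hv) hv1
    · exact hd v hv hv1
    · exact dW v hv (hS hv1)

lemma stepS [Finite V] (h23 : NoK23 G) (S : Set V) (x y : V) (hx : x ∈ S) (hy : y ∈ S)
    (hxy : x ≠ y) (h0 : S0 G S x y) (hl : G.Adj x y ∨ Wk G S x y)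
    (ihT : ∀ S' : Set V, S' ⊂ S → ∀ x ∈ S', OrdT G S' x)
    (ihS : ∀ S' : Set V, S' ⊂ S → ∀ x ∈ S', ∀ y ∈ S', x ≠ y → Wk G S' x y → OrdS G S' x y) :
    OrdS G S x y := by
  set C := S \ {x, y} with hCdef
  have hC : ∀ v, v ∈ C ↔ v ∈ S ∧ v ≠ x ∧ v ≠ y := by
    intro v; simp [hCdef]
  have hcase : (∀ D, ¬ Ctr G C {v | G.Adj x v} {v | G.Adj y v} D) ∨
      ((∃ D, Ctr G C {v | G.Adj x v} {v | G.Adj y v} D) ∧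
        ∃ z ∈ C, ∀ D, Ctr G C {v | G.Adj x v} {v | G.Adj y v} D → z ∈ D) := by
    have := menger _ C {v | G.Adj x v} {v | G.Adj y v} rfl h0
    by_cases h : ∃ D, Ctr G C {v | G.Adj x v} {v | G.Adj y v} D
    · exact Or.inr ⟨h, this.resolve_left fun h' => h.elim h'⟩
    · exact Or.inl fun D hD => h ⟨D, hD⟩
  rcases hcase with hnone | ⟨hex, z, hzC, hz⟩
  · -- not connected
    let L : Set V := {v | ∃ K, Cn G K ∧ K ⊆ C ∧ v ∈ K ∧ ∃ a ∈ K, G.Adj x a}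
    have LC : ∀ v ∈ L, v ∈ C := fun v ⟨K, _, hK, hv, _⟩ => hK hv
    have yL : y ∉ L := fun h => ((hC y).1 (LC y h)).2.2 rfl
    have xL : x ∉ L := fun h => ((hC x).1 (LC x h)).2.1 rfl
    have sub1 : {x} ∪ L ⊆ S := by
      rintro v (rfl | hv)
      · exact hx
      · exact ((hC v).1 (LC v hv)).1
    have hyX : y ∉ {x} ∪ L := by
      rintro (h | h)
      · exact hxy h.symm
      · exact yL h
    refine glue_disj (S₁ := {x} ∪ L) (S₂ := S \ ({x} ∪ L))
      (ihT _ ⟨sub1, fun h => hyX (h hy)⟩ x (Or.inl rfl))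
      (ihT _ ⟨fun v hv => hv.1, fun h => (h hx).2 (Or.inl rfl)⟩ y ⟨hy, hyX⟩)
      (Or.inl rfl) ⟨hy, hyX⟩ ?_ ?_ ?_
    · intro v
      constructor
      · intro hv
        by_cases h : v ∈ {x} ∪ L
        · exact Or.inl h
        · exact Or.inr ⟨hv, h⟩
      · rintro (h | h)
        · exact sub1 h
        · exact h.1
    · intro v hv hv'; exact hv'.2 hv
    · rintro v hv w ⟨hwS, hwX⟩ hvw
      have hwx : w ≠ x := fun h => hwX (Or.inl h)
      have hwL : w ∉ L := fun h => hwX (Or.inr h)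
      rcases hv with rfl | ⟨K, cK, hKC, hvK, a, ha, hxa⟩
      · refine ⟨rfl, ?_⟩
        by_contra hwy
        have hwC := (hC w).2 ⟨hwS, hwx, hwy⟩
        exact hwL ⟨{w}, cn_single w, by simpa using hwC, rfl, w, rfl, hvw⟩
      · exfalso
        by_cases hwy : w = y
        · subst hwy
          exact hnone K ⟨hKC, cK, ⟨a, ha, hxa⟩, ⟨v, hvK, hvw.symm⟩⟩
        · have hwC := (hC w).2 ⟨hwS, hwx, hwy⟩
          exact hwL ⟨K ∪ {w}, cn_union_tch cK (cn_single w) ⟨v, hvK, w, rfl, hvw⟩,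
            Set.union_subset hKC (by simpa using hwC), Or.inr rfl, a, Or.inl ha, hxa⟩
  · obtain ⟨K₀, hK₀⟩ := hex
    have hzK₀ := hz K₀ hK₀
    obtain ⟨hK₀C, cK₀, ⟨a₀, ha₀, ha₀x⟩, ⟨b₀, hb₀, hb₀y⟩⟩ := hK₀
    obtain ⟨hzS, hzx, hzy⟩ := (hC z).1 hzC
    let L : Set V := {v | ∃ K, Cn G K ∧ K ⊆ C ∧ z ∉ K ∧ v ∈ K ∧ ∃ a ∈ K, G.Adj x a}
    have LC : ∀ v ∈ L, v ∈ C := fun v ⟨K, _, hK, _, hv, _⟩ => hK hv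
    have zL : z ∉ L := fun ⟨_, _, _, h1, h2, _⟩ => h1 h2
    have yL : y ∉ L := fun h => ((hC y).1 (LC y h)).2.2 rfl
    have xL : x ∉ L := fun h => ((hC x).1 (LC x h)).2.1 rfl
    have sub1 : {x} ∪ L ⊆ S := by
      rintro v (rfl | hv)
      · exact hx
      · exact ((hC v).1 (LC v hv)).1
    have hyX : y ∉ {x} ∪ L := by
      rintro (h | h)
      · exact hxy h.symm
      · exact yL h
    have hzX : z ∉ {x} ∪ L := by
      rintro (h | h)
      · exact hzx h
      · exact zL h
    have sub2 : insert z ({x} ∪ L) ⊆ S := Set.insert_subset hzS sub1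
    have hyX' : y ∉ insert z ({x} ∪ L) := by
      rintro (h | h)
      · exact hzy h.symm
      · exact hyX h
    have w1 : Wk G (insert z ({x} ∪ L)) x z := by
      by_cases hbz : b₀ = z
      · subst hbz
        refine wk_extend hl (cn_single y) rfl ⟨b₀, rfl, y, rfl, (show G.Adj y b₀ from hb₀y).symm⟩
          sub2 ?_
        rintro v rfl; exact hyX'
      · obtain ⟨E, cE, hbE, hEK, hER, e, he, r, ⟨rfl, _⟩, her⟩ := compTouch cK₀ (cn_single b₀)
          (by simpa using hb₀) (R := {z}) (by rintro v rfl h; exact hbz h) ⟨z, hzK₀, rfl⟩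
        refine wk_extend (C := {y} ∪ E) hl (cn_union_tch (cn_single y) cE
          ⟨y, rfl, b₀, hbE rfl, hb₀y⟩) (Or.inl rfl) ⟨r, rfl, e, Or.inr he, her.symm⟩ sub2 ?_
        rintro v (rfl | hv)
        · exact hyX'
        · rintro (rfl | rfl | ⟨K, cK, hKC, hzK, hvK, a, ha, hxa⟩)
          · exact hER _ hv rfl
          · exact ((hC v).1 (hK₀C (hEK hv))).2.1 rfl
          · have := hz (K ∪ E) ⟨Set.union_subset hKC (hEK.trans hK₀C),
              cn_union_meet cK cE hvK hv, ⟨a, Or.inl ha, hxa⟩, ⟨b₀, Or.inr (hbE rfl), hb₀y⟩⟩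
            rcases this with h | h
            · exact hzK h
            · exact hER _ h rfl
    have hl' : G.Adj y x ∨ Wk G S y x := by
      rcases hl with h | ⟨W, h1, h2, h3, h4⟩
      · exact Or.inl h.symm
      · exact Or.inr ⟨W, h1, h2, h4, h3⟩
    have w2' : Wk G (S \ ({x} ∪ L)) y z := by
      by_cases haz : a₀ = z
      · subst haz
        refine wk_extend hl' (cn_single x) rfl ⟨a₀, rfl, x, rfl, (show G.Adj x a₀ from ha₀x).symm⟩
          (fun v hv => hv.1) ?_
        rintro v rfl h
        exact h.2 (Or.inl rfl)
      · obtain ⟨E, cE, haE, hEK, hER, e, he, r, ⟨rfl, _⟩, her⟩ := compTouch cK₀ (cn_single a₀)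
          (by simpa using ha₀) (R := {z}) (by rintro v rfl h; exact haz h) ⟨z, hzK₀, rfl⟩
        refine wk_extend (C := {x} ∪ E) hl' (cn_union_tch (cn_single x) cE
          ⟨x, rfl, a₀, haE rfl, ha₀x⟩) (Or.inl rfl) ⟨r, rfl, e, Or.inr he, her.symm⟩
          (fun v hv => hv.1) ?_
        rintro v (rfl | hv) h
        · exact h.2 (Or.inl rfl)
        · exact h.2 (Or.inr ⟨E, cE, hEK.trans hK₀C, fun h => hER _ h rfl, hv, a₀, haE rfl, ha₀x⟩)
    have w2 : Wk G (S \ ({x} ∪ L)) z y := by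
      obtain ⟨W, h1, h2, h3, h4⟩ := w2'
      exact ⟨W, h1, h2, h4, h3⟩
    refine glue_z (S₁ := insert z ({x} ∪ L)) (S₂ := S \ ({x} ∪ L)) (z := z)
      (ihS _ ⟨sub2, fun h => hyX' (h hy)⟩ x (Or.inr (Or.inl rfl)) z (Or.inl rfl) hzx.symm w1)
      (ihS (S \ ({x} ∪ L)) ⟨fun v hv => hv.1, fun h => (h hx).2 (Or.inl rfl)⟩ z ⟨hzS, hzX⟩ y ⟨hy, hyX⟩ hzy w2)
      (Or.inr (Or.inl rfl)) ⟨hy, hyX⟩ (Or.inl rfl) ⟨hzS, hzX⟩ hzy.symm ?_ ?_ ?_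
    · intro v
      constructor
      · intro hv
        by_cases h : v ∈ {x} ∪ L
        · exact Or.inl (Or.inr h)
        · exact Or.inr ⟨hv, h⟩
      · rintro (h | h)
        · exact sub2 h
        · exact h.1
    · rintro v (h | h) h'
      · exact h
      · exact absurd h h'.2
    · rintro v hv w ⟨hwS, hwX⟩ hvz hwz hvw
      have hwx : w ≠ x := fun h => hwX (Or.inl h)
      have hwL : w ∉ L := fun h => hwX (Or.inr h)
      rcases hv with hv | rfl | ⟨K, cK, hKC, hzK, hvK, a, ha, hxa⟩
      · exact absurd hv hvz
      · refine ⟨rfl, ?_⟩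
        by_contra hwy
        have hwC := (hC w).2 ⟨hwS, hwx, hwy⟩
        exact hwL ⟨{w}, cn_single w, by simpa using hwC, fun h => hwz h.symm, rfl, w, rfl, hvw⟩
      · exfalso
        by_cases hwy : w = y
        · subst hwy
          exact hzK (hz K ⟨hKC, cK, ⟨a, ha, hxa⟩, ⟨v, hvK, hvw.symm⟩⟩)
        · have hwC := (hC w).2 ⟨hwS, hwx, hwy⟩
          refine hwL ⟨K ∪ {w}, cn_union_tch cK (cn_single w) ⟨v, hvK, w, rfl, hvw⟩,
            Set.union_subset hKC (by simpa using hwC), ?_, Or.inr rfl, a, Or.inl ha, hxa⟩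
          rintro (h | h)
          · exact hzK h
          · exact hwz h.symm

/-- choice of an extreme neighbour -/
lemma extreme [Finite V] {U N : Set V} (hU : Cn G U) (hN : N ⊆ U) (hne : N.Nonempty) :
    ∃ y ∈ N, ∃ K : Set V, K ⊆ U ∧ y ∉ K ∧ (K = ∅ ∨ Cn G K) ∧ ∀ n ∈ N, n ≠ y → n ∈ K := by
  obtain ⟨y₀, hy₀⟩ := hne
  obtain ⟨K, hK, hmax⟩ := Set.Finite.exists_maximal
    (s := {K : Set V | K ⊆ U ∧ (K = ∅ ∨ Cn G K) ∧ ∃ y ∈ N, y ∉ K}) (Set.toFinite _)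
    ⟨∅, by simp, Or.inl rfl, y₀, hy₀, by simp⟩
  obtain ⟨hKU, hKc, y, hyN, hyK⟩ := hK
  refine ⟨y, hyN, K, hKU, hyK, hKc, ?_⟩
  intro n hn hny
  by_contra hnK
  obtain ⟨w, hw, hwK, hc⟩ : ∃ w ∈ U, w ∉ K ∧ Cn G (K ∪ {w}) := by
    rcases hKc with rfl | hKc
    · exact ⟨n, hN hn, hnK, by simpa using cn_single n⟩
    · obtain ⟨k, hk⟩ := hKc.1
      obtain ⟨a, _, b, hb, haK, hbK, hab⟩ := hU.2 K ⟨k, hKU hk, hk⟩ ⟨n, hN hn, hnK⟩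
      exact ⟨b, hb, hbK, cn_union_tch hKc (cn_single b) ⟨a, haK, b, rfl, hab⟩⟩
  have : ∃ y' ∈ N, y' ∉ K ∪ {w} := by
    by_cases h : y = w
    · refine ⟨n, hn, ?_⟩
      rintro (h' | h')
      · exact hnK h'
      · exact hny (h'.trans h.symm)
    · refine ⟨y, hyN, ?_⟩
      rintro (h' | h')
      · exact hyK h'
      · exact h h'
  have := hmax (y := K ∪ {w}) ⟨Set.union_subset hKU (by simpa using hw), Or.inr hc, this⟩
    Set.subset_union_left
  exact hwK (this (Or.inr rfl))

lemma stepT [Finite V] (h4 : NoK4 G) (S : Set V) (x : V) (hx : x ∈ S)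
    (ihT : ∀ S' : Set V, S' ⊂ S → ∀ x ∈ S', OrdT G S' x)
    (hS : ∀ y ∈ S, x ≠ y → G.Adj x y → S0 G S x y → OrdS G S x y) :
    OrdT G S x := by
  by_cases hne : (S \ {x}).Nonempty
  swap
  · have hall : ∀ v ∈ S, v = x := by
      intro v hv
      by_contra h
      exact hne ⟨v, hv, h⟩
    refine ⟨fun _ => 0, ⟨?_, ?_⟩, by simp⟩
    · intro a ha b hb _
      rw [hall a ha, hall b hb]
    · intro a _ b _ c _ d _ h
      simp at h
  by_cases hU : Cn G (S \ {x})
  swap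
  · -- disconnected
    unfold Cn at hU
    push Not at hU
    obtain ⟨T, ⟨a, ha, haT⟩, ⟨b, hb, hbT⟩, hno⟩ := hU hne
    refine glue_cut (S₁ := {v | v ∈ S ∧ (v = x ∨ v ∈ T)}) (S₂ := {v | v ∈ S ∧ (v = x ∨ v ∉ T)})
      (ihT _ ⟨fun v hv => hv.1, fun h => ?_⟩ x ⟨hx, Or.inl rfl⟩)
      (ihT _ ⟨fun v hv => hv.1, fun h => ?_⟩ x ⟨hx, Or.inl rfl⟩)
      ⟨hx, Or.inl rfl⟩ ⟨hx, Or.inl rfl⟩ ?_ ?_ ?_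
    · rcases (h hb.1).2 with h | h
      · exact hb.2 h
      · exact hbT h
    · rcases (h ha.1).2 with h | h
      · exact ha.2 h
      · exact h haT
    · intro v
      simp only [Set.mem_ofPred_eq]
      tauto
    · rintro v ⟨_, h1⟩ ⟨_, h2⟩
      tauto
    · rintro v ⟨hv, h1⟩ w ⟨hw, h2⟩ hvx hwx
      exact hno v ⟨hv, hvx⟩ w ⟨hw, hwx⟩ (h1.resolve_left hvx) (h2.resolve_left hwx)
  by_cases hN : ∃ y ∈ S, G.Adj x y
  swap
  · obtain ⟨r, hr⟩ := hne
    push Not at hN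
    obtain ⟨f, hf, h1, _⟩ : OrdS G S x r := by
      refine glue_disj (S₁ := {x}) (S₂ := S \ {x}) ⟨fun _ => 0, ⟨?_, ?_⟩, by simp⟩
        (ihT _ ⟨fun v hv => hv.1, fun h => (h hx).2 rfl⟩ r hr) rfl hr ?_ ?_ ?_
      · rintro a rfl b rfl _; rfl
      · intro a _ b _ c _ d _ h
        simp at h
      · intro v
        by_cases h : v = x
        · subst h; simp [hx]
        · simp [h]
      · rintro v rfl h; exact h.2 rfl
      · rintro v rfl w hw h
        exact absurd h (hN w hw.1)
    exact ⟨f, hf, h1⟩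
  obtain ⟨y₀, hy₀, hxy₀⟩ := hN
  obtain ⟨y, ⟨hyS, hxy⟩, K, hKU, hyK, hKc, hNK⟩ := extreme (N := {v | v ∈ S ∧ G.Adj x v}) hU
    (fun v hv => ⟨hv.1, fun h => by
      have h : v = x := h
      subst h; exact G.loopless.irrefl _ hv.2⟩)
    ⟨y₀, hy₀, hxy₀⟩
  obtain ⟨f, hf, h1, _⟩ : OrdS G S x y := by
    refine hS y hyS hxy.ne hxy ?_
    rintro D₁ D₂ ⟨hD1, c1, ⟨a1, ha1, ha1'⟩, ⟨b1, hb1, hb1'⟩⟩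
      ⟨hD2, c2, ⟨a2, ha2, ha2'⟩, ⟨b2, hb2, hb2'⟩⟩ hd
    have a1K : a1 ∈ K := hNK a1 ⟨(hD1 ha1).1, ha1'⟩ (fun h => (hD1 ha1).2 (Or.inr h))
    have a2K : a2 ∈ K := hNK a2 ⟨(hD2 ha2).1, ha2'⟩ (fun h => (hD2 ha2).2 (Or.inr h))
    have cK : Cn G K := by
      rcases hKc with rfl | h
      · exact absurd a1K (by simp)
      · exact h
    have cU := cn_union_meet (cn_union_meet cK c1 a1K ha1) c2 (Or.inl a2K) ha2
    obtain ⟨E, cE, hDE, hEU, hER, hET⟩ := compTouch cU c1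
      (fun v hv => Or.inl (Or.inr hv)) hd ⟨a2, Or.inr ha2, ha2⟩
    have hU' : ∀ v ∈ (K ∪ D₁) ∪ D₂, v ≠ x ∧ v ≠ y := by
      rintro v ((hv | hv) | hv)
      · exact ⟨(hKU hv).2, by rintro rfl; exact hyK hv⟩
      · exact ⟨fun h => (hD1 hv).2 (Or.inl h), fun h => (hD1 hv).2 (Or.inr h)⟩
      · exact ⟨fun h => (hD2 hv).2 (Or.inl h), fun h => (hD2 hv).2 (Or.inr h)⟩
    refine h4 {x} {y} E D₂ (cn_single x) (cn_single y) cE c2 ?_ ?_ ?_ ?_ ?_ hER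
      ⟨x, rfl, y, rfl, hxy⟩ ⟨x, rfl, a1, hDE ha1, ha1'⟩ ⟨x, rfl, a2, ha2, ha2'⟩
      ⟨y, rfl, b1, hDE hb1, hb1'⟩ ⟨y, rfl, b2, hb2, hb2'⟩
      (hET.mono subset_rfl Set.inter_subset_left)
    · rintro v rfl h; exact hxy.ne h
    · rintro v rfl h; exact (hU' _ (hEU h)).1 rfl
    · rintro v rfl h; exact (hU' _ (Or.inr h)).1 rfl
    · rintro v rfl h; exact (hU' _ (hEU h)).2 rfl
    · rintro v rfl h; exact (hU' _ (Or.inr h)).2 rfl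
  exact ⟨f, hf, h1⟩

lemma exists_order [Finite V] (h4 : NoK4 G) (h23 : NoK23 G) (n : ℕ) : ∀ S : Set V, S.ncard = n →
    (∀ x ∈ S, OrdT G S x) ∧
    (∀ x ∈ S, ∀ y ∈ S, x ≠ y → S0 G S x y → (G.Adj x y ∨ Wk G S x y) → OrdS G S x y) := by
  induction n using Nat.strong_induction_on with
  | _ n ih =>
    intro S hn
    have ihT : ∀ S' : Set V, S' ⊂ S → ∀ x ∈ S', OrdT G S' x := fun S' hS' =>
      (ih S'.ncard (hn ▸ Set.ncard_lt_ncard hS') S' rfl).1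
    have ihS : ∀ S' : Set V, S' ⊂ S → ∀ x ∈ S', ∀ y ∈ S', x ≠ y → Wk G S' x y →
        OrdS G S' x y := fun S' hS' x hx y hy hxy hW =>
      (ih S'.ncard (hn ▸ Set.ncard_lt_ncard hS') S' rfl).2 x hx y hy hxy
        (s0_of_wk h23 hx hy hxy hW) (Or.inr hW)
    have hS : ∀ x ∈ S, ∀ y ∈ S, x ≠ y → S0 G S x y → (G.Adj x y ∨ Wk G S x y) → OrdS G S x y :=
      fun x hx y hy hxy h0 hl => stepS h23 S x y hx hy hxy h0 hl ihT ihS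
    exact ⟨fun x hx => stepT h4 S x hx ihT fun y hy hxy hadj h0 => hS x hx y hy hxy h0 (Or.inl hadj),
      hS⟩

lemma exists_nc [Finite V] [Nonempty V] (h : Outerplanar G) : ∃ f, NC G f Set.univ := by
  obtain ⟨x⟩ := ‹Nonempty V›
  obtain ⟨f, hf, _⟩ := (exists_order (noK4_of h.1) (noK23_of h.2) _ Set.univ rfl).1 x trivial
  exact ⟨f, hf⟩

end
end MOP

namespace MOP
section
variable {V : Type*} {G : SimpleGraph V}

/-- maximality in terms of a placement -/
lemma max_cross (h : MaximalOuterplanar G) {f : V → ℤ} (hf : NC G f Set.univ) (u v : V)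
    (huv : f u < f v) (hadj : ¬ G.Adj u v) :
    ∃ p q, G.Adj p q ∧ f u < f p ∧ f p < f v ∧ (f q < f u ∨ f v < f q) := by
  by_contra hcon
  push Not at hcon
  have hne : u ≠ v := by rintro rfl; exact lt_irrefl _ huv
  refine h.2 u v hne hadj (outerplanar_of_nc (f := f) ⟨hf.1, ?_⟩)
  have e : ∀ a c, (G ⊔ SimpleGraph.fromEdgeSet {s(u, v)}).Adj a c → f a < f c →
      G.Adj a c ∨ (a = u ∧ c = v) := by
    intro a c hac hlt
    rw [SimpleGraph.sup_adj, SimpleGraph.fromEdgeSet_adj] at hac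
    rcases hac with hac | ⟨hac, _⟩
    · exact Or.inl hac
    · simp only [Set.mem_singleton_iff, Sym2.eq_iff] at hac
      rcases hac with hac | ⟨rfl, rfl⟩
      · exact Or.inr hac
      · omega
  intro a _ b _ c _ d _ h1 h2 h3 hac hbd
  rcases e a c hac (by omega) with gac | ⟨rfl, rfl⟩ <;>
    rcases e b d hbd (by omega) with gbd | ⟨rfl, rfl⟩
  · exact hf.2 a trivial b trivial c trivial d trivial h1 h2 h3 gac gbd
  · have := (hcon c a gac.symm h2 h3).1
    omega
  · have := (hcon b d gbd h1 h2).2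
    omega
  · omega

/-- apex of the triangle below an edge -/
lemma apex [Finite V] (h : MaximalOuterplanar G) {f : V → ℤ} (hf : NC G f Set.univ) (i j : V)
    (hij : G.Adj i j) (hw : ∃ w, f i < f w ∧ f w < f j) :
    ∃ k, f i < f k ∧ f k < f j ∧ G.Adj i k ∧ G.Adj k j := by
  have nc : ∀ a b c d, f a < f b → f b < f c → f c < f d → G.Adj a c → G.Adj b d → False :=
    fun a b c d => hf.2 a trivial b trivial c trivial d trivial
  have inj : ∀ u v, f u = f v → u = v := fun u v => hf.1 u trivial v trivial
  obtain ⟨m, ⟨hm1, hm2⟩, hmin⟩ := Set.exists_min_image {w | f i < f w ∧ f w < f j} f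
    (Set.toFinite _) hw
  have him : G.Adj i m := by
    by_contra hno
    obtain ⟨p, q, hpq, h1, h2, _⟩ := max_cross h hf i m hm1 hno
    have := hmin p ⟨h1, by omega⟩
    omega
  obtain ⟨k, ⟨hk1, hk2, hk3⟩, hmax⟩ := Set.exists_max_image
    {w | f i < f w ∧ f w < f j ∧ G.Adj i w} f (Set.toFinite _) ⟨m, hm1, hm2, him⟩
  refine ⟨k, hk1, hk2, hk3, ?_⟩
  by_contra hno
  obtain ⟨p, q, hpq, h1, h2, h3⟩ := max_cross h hf k j hk2 hno
  rcases h3 with h3 | h3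
  · rcases lt_trichotomy (f q) (f i) with hq | hq | hq
    · exact nc q i p j hq (by omega) h2 hpq.symm hij
    · have := inj _ _ hq
      subst this
      have := hmax p ⟨by omega, h2, hpq.symm⟩
      omega
    · exact nc i q k p hq h3 h1 hk3 hpq.symm
  · exact nc i p j q (by omega) h2 h3 hij hpq

/-- a vertex is well coloured -/
def Good (G : SimpleGraph V) (c : V → Fin 4) (v : V) : Prop :=
  (∀ x : Fin 4, ∃ u, (u = v ∨ G.Adj v u) ∧ c u = x) ∨
  (∃ a b, G.Adj v a ∧ G.Adj v b ∧ (∀ u, G.Adj v u → u = a ∨ u = b) ∧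
    c v ≠ c a ∧ c v ≠ c b ∧ c a ≠ c b)

lemma good_congr {c c₁ : V → Fin 4} {v : V} (h : ∀ u, (u = v ∨ G.Adj v u) → c u = c₁ u)
    (hg : Good G c₁ v) : Good G c v := by
  rcases hg with hg | ⟨a, b, ha, hb, hall, h1, h2, h3⟩
  · left
    intro x
    obtain ⟨u, hu, hx⟩ := hg x
    exact ⟨u, hu, (h u hu).trans hx⟩
  · right
    refine ⟨a, b, ha, hb, hall, ?_⟩
    rw [h v (Or.inl rfl), h a (Or.inr ha), h b (Or.inr hb)]
    exact ⟨h1, h2, h3⟩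

lemma fin4_cover (α β γ δ x : Fin 4) (h1 : α ≠ β) (h2 : α ≠ γ) (h3 : α ≠ δ) (h4 : β ≠ γ)
    (h5 : β ≠ δ) (h6 : γ ≠ δ) : x = α ∨ x = β ∨ x = γ ∨ x = δ := by
  omega

lemma colouring [Finite V] (h : MaximalOuterplanar G) {f : V → ℤ} (hf : NC G f Set.univ) (n : ℕ) :
    ∀ i j, G.Adj i j → f i < f j → f j - f i = n → ∀ α β γ δ : Fin 4, α ≠ β → α ≠ γ → α ≠ δ →
    β ≠ γ → β ≠ δ → γ ≠ δ →
    ∃ c : V → Fin 4, c i = α ∧ c j = β ∧ (∀ w, f i < f w → f w < f j → Good G c w) ∧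
      ((∃ w, f i < f w ∧ f w < f j) →
        ∃ k, f i < f k ∧ f k < f j ∧ G.Adj i k ∧ G.Adj k j ∧ c k = δ ∧
          (Good G c i ∨ (∀ w, ¬ (f i < f w ∧ f w < f k))) ∧
          (Good G c j ∨ (∀ w, ¬ (f k < f w ∧ f w < f j)))) := by
  classical
  have nc : ∀ a b c d, f a < f b → f b < f c → f c < f d → G.Adj a c → G.Adj b d → False :=
    fun a b c d => hf.2 a trivial b trivial c trivial d trivial
  have inj : ∀ u v, f u = f v → u = v := fun u v => hf.1 u trivial v trivial
  induction n using Nat.strong_induction_on with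
  | _ n ih =>
  intro i j hij hlt hn α β γ δ h1 h2 h3 h4 h5 h6
  by_cases hw : ∃ w, f i < f w ∧ f w < f j
  swap
  · have hne : i ≠ j := hij.ne
    refine ⟨fun v => if v = i then α else β, by simp, by simp [hne.symm], ?_, fun h => absurd h hw⟩
    intro w hw1 hw2
    exact absurd ⟨w, hw1, hw2⟩ hw
  obtain ⟨k, hk1, hk2, hik, hkj⟩ := apex h hf i j hij hw
  obtain ⟨c₁, c1i, c1k, g1, a1⟩ := ih (f k - f i).toNat (by omega) i k hik hk1 (by omega)
    α δ β γ h3 h1 h2 h5.symm h6.symm h4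
  obtain ⟨c₂, c2k, c2j, g2, a2⟩ := ih (f j - f k).toNat (by omega) k j hkj hk2 (by omega)
    δ β α γ h5.symm h3.symm h6.symm h1.symm h4 h2
  let c : V → Fin 4 := fun v => if f v ≤ f k then c₁ v else c₂ v
  have cc1 : ∀ v, f v ≤ f k → c v = c₁ v := fun v hv => by simp [c, hv]
  have cc2 : ∀ v, f k ≤ f v → c v = c₂ v := fun v hv => by
    by_cases hv' : f v ≤ f k
    · have := inj _ _ (le_antisymm hv' hv)
      subst this
      simp [c, c1k, c2k]
    · simp [c, hv']
  have ci : c i = α := (cc1 i (by omega)).trans c1i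
  have cj : c j = β := (cc2 j (by omega)).trans c2j
  have ck : c k = δ := (cc1 k le_rfl).trans c1k
  -- neighbours stay inside an interval
  have inside : ∀ a b w u, G.Adj a b → f a < f w → f w < f b → G.Adj w u →
      f a ≤ f u ∧ f u ≤ f b := by
    intro a b w u hab haw hwb hwu
    constructor
    · by_contra hlt
      exact nc u a w b (by omega) haw hwb hwu.symm hab
    · by_contra hlt
      exact nc a w b u haw hwb (by omega) hab hwu
  have cover : ∀ x, x = α ∨ x = β ∨ x = γ ∨ x = δ := fun x =>
    fin4_cover α β γ δ x h1 h2 h3 h4 h5 h6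
  refine ⟨c, ci, cj, ?_, fun _ => ⟨k, hk1, hk2, hik, hkj, ck, ?_, ?_⟩⟩
  · intro w hw1 hw2
    rcases lt_trichotomy (f w) (f k) with hwk | hwk | hwk
    · refine good_congr ?_ (g1 w hw1 hwk)
      rintro u (rfl | hu)
      · exact cc1 _ hwk.le
      · exact cc1 _ (inside i k w u hik hw1 hwk hu).2
    · have := inj _ _ hwk
      subst this
      by_cases e1 : ∃ v, f i < f v ∧ f v < f w
      · obtain ⟨l, hl1, hl2, hl3, hl4, hl5, _⟩ := a1 e1
        left
        intro x
        rcases cover x with rfl | rfl | rfl | rfl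
        · exact ⟨i, Or.inr hik.symm, ci⟩
        · exact ⟨j, Or.inr hkj, cj⟩
        · exact ⟨l, Or.inr hl4.symm, (cc1 l hl2.le).trans hl5⟩
        · exact ⟨w, Or.inl rfl, ck⟩
      by_cases e2 : ∃ v, f w < f v ∧ f v < f j
      · obtain ⟨l, hl1, hl2, hl3, hl4, hl5, _⟩ := a2 e2
        left
        intro x
        rcases cover x with rfl | rfl | rfl | rfl
        · exact ⟨i, Or.inr hik.symm, ci⟩
        · exact ⟨j, Or.inr hkj, cj⟩
        · exact ⟨l, Or.inr hl3, (cc2 l hl1.le).trans hl5⟩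
        · exact ⟨w, Or.inl rfl, ck⟩
      right
      refine ⟨i, j, hik.symm, hkj, ?_, ?_⟩
      · intro u hu
        have := inside i j w u hij hw1 hw2 hu
        by_contra hne
        push Not at hne
        have n1 : f u ≠ f i := fun h => hne.1 (inj _ _ h)
        have n2 : f u ≠ f j := fun h => hne.2 (inj _ _ h)
        have n3 : f u ≠ f w := fun h => hu.ne (inj _ _ h).symm
        rcases lt_or_gt_of_ne n3 with h | h
        · exact e1 ⟨u, by omega, h⟩
        · exact e2 ⟨u, h, by omega⟩
      · rw [ci, cj, ck]
        exact ⟨h3.symm, h5.symm, h1⟩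
    · refine good_congr ?_ (g2 w hwk hw2)
      rintro u (rfl | hu)
      · exact cc2 _ hwk.le
      · exact cc2 _ (inside k j w u hkj hwk hw2 hu).1
  · by_cases e1 : ∃ v, f i < f v ∧ f v < f k
    · obtain ⟨l, hl1, hl2, hl3, hl4, hl5, _⟩ := a1 e1
      left; left
      intro x
      rcases cover x with rfl | rfl | rfl | rfl
      · exact ⟨i, Or.inl rfl, ci⟩
      · exact ⟨j, Or.inr hij, cj⟩
      · exact ⟨l, Or.inr hl3, (cc1 l hl2.le).trans hl5⟩
      · exact ⟨k, Or.inr hik, ck⟩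
    · exact Or.inr (not_exists.1 e1)
  · by_cases e2 : ∃ v, f k < f v ∧ f v < f j
    · obtain ⟨l, hl1, hl2, hl3, hl4, hl5, _⟩ := a2 e2
      left; left
      intro x
      rcases cover x with rfl | rfl | rfl | rfl
      · exact ⟨i, Or.inr hij.symm, ci⟩
      · exact ⟨j, Or.inl rfl, cj⟩
      · exact ⟨l, Or.inr hl4.symm, (cc2 l hl1.le).trans hl5⟩
      · exact ⟨k, Or.inr hkj.symm, ck⟩
    · exact Or.inr (not_exists.1 e2)

lemma exists_colouring [Fintype V] (h : MaximalOuterplanar G) (hn : 3 ≤ Fintype.card V) :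
    ∃ c : V → Fin 4, ∀ v, Good G c v := by
  classical
  have : Nonempty V := Fintype.card_pos_iff.1 (by omega)
  obtain ⟨f, hf⟩ := exists_nc h.1
  have nc : ∀ a b c d, f a < f b → f b < f c → f c < f d → G.Adj a c → G.Adj b d → False :=
    fun a b c d => hf.2 a trivial b trivial c trivial d trivial
  have inj : ∀ u v, f u = f v → u = v := fun u v => hf.1 u trivial v trivial
  obtain ⟨i, hi⟩ := Finite.exists_min f
  obtain ⟨j, hj⟩ := Finite.exists_max f
  obtain ⟨w, hw⟩ : ∃ w, w ∉ ({i, j} : Finset V) := by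
    by_contra hcon
    push Not at hcon
    have h1 : Finset.univ ⊆ ({i, j} : Finset V) := fun v _ => hcon v
    have h2 := Finset.card_le_card h1
    have h3 := Finset.card_le_two (a := i) (b := j)
    rw [Finset.card_univ] at h2
    omega
  simp only [Finset.mem_insert, Finset.mem_singleton, not_or] at hw
  have hwi : f i < f w := lt_of_le_of_ne (hi w) fun h => hw.1 (inj _ _ h).symm
  have hwj : f w < f j := lt_of_le_of_ne (hj w) fun h => hw.2 (inj _ _ h)
  have hij : G.Adj i j := by
    by_contra hno
    obtain ⟨p, q, _, _, _, h3⟩ := max_cross h hf i j (by omega) hno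
    have := hi q
    have := hj q
    omega
  obtain ⟨c, ci, cj, hg, ha⟩ := colouring h hf (f j - f i).toNat i j hij (by omega) (by omega)
    0 1 2 3 (by decide) (by decide) (by decide) (by decide) (by decide) (by decide)
  obtain ⟨k, hk1, hk2, hik, hkj, ck, gi, gj⟩ := ha ⟨w, hwi, hwj⟩
  refine ⟨c, fun v => ?_⟩
  by_cases hvi : v = i
  · subst hvi
    rcases gi with gi | gi
    · exact gi
    right
    refine ⟨j, k, hij, hik, ?_, by rw [ci, cj]; decide, by rw [ci, ck]; decide,
      by rw [cj, ck]; decide⟩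
    intro u hu
    by_contra hne
    push Not at hne
    have n1 : f u ≠ f j := fun h => hne.1 (inj _ _ h)
    have n2 : f u ≠ f k := fun h => hne.2 (inj _ _ h)
    have n3 : f v ≠ f u := fun h => hu.ne (inj _ _ h)
    have := hi u
    have := hj u
    rcases lt_or_gt_of_ne n2 with h | h
    · exact gi u ⟨by omega, h⟩
    · exact nc v k u j hk1 h (by omega) hu hkj
  by_cases hvj : v = j
  · subst hvj
    rcases gj with gj | gj
    · exact gj
    right
    refine ⟨i, k, hij.symm, hkj.symm, ?_, by rw [ci, cj]; decide, by rw [cj, ck]; decide,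
      by rw [ci, ck]; decide⟩
    intro u hu
    by_contra hne
    push Not at hne
    have n1 : f u ≠ f i := fun h => hne.1 (inj _ _ h)
    have n2 : f u ≠ f k := fun h => hne.2 (inj _ _ h)
    have n3 : f v ≠ f u := fun h => hu.ne (inj _ _ h)
    have := hi u
    have := hj u
    rcases lt_or_gt_of_ne n2 with h | h
    · exact nc i u k v (by omega) h hk2 hik hu.symm
    · exact gj u ⟨h, by omega⟩
  exact hg v (lt_of_le_of_ne (hi v) fun h => hvi (inj _ _ h).symm)
    (lt_of_le_of_ne (hj v) fun h => hvj (inj _ _ h))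

lemma two_le_inter [DecidableEq V] {A B : Finset V} {u w : V} (hu : u ∈ A) (hu' : u ∈ B)
    (hw : w ∈ A) (hw' : w ∈ B) (hne : u ≠ w) : 2 ≤ (A ∩ B).card := by
  have : 1 < (A ∩ B).card :=
    Finset.one_lt_card.2 ⟨u, Finset.mem_inter.2 ⟨hu, hu'⟩, w, Finset.mem_inter.2 ⟨hw, hw'⟩, hne⟩
  exact this

lemma repair [Fintype V] [DecidableEq V] [DecidableRel G.Adj] (D M : Finset V)
    (hM : ∀ v ∈ M, (∃ u ∈ insert v (G.neighborFinset v), u ∈ D) ∧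
      ∃ u ∈ insert v (G.neighborFinset v), u ∉ D)
    (hD : ∀ v, v ∉ M → 2 ≤ (D ∩ insert v (G.neighborFinset v)).card) :
    doubleDomNum G ≤ D.card + M.card := by
  have : ∀ v : V, ∃ u, v ∈ M → u ∈ insert v (G.neighborFinset v) ∧ u ∉ D := by
    intro v
    by_cases hv : v ∈ M
    · obtain ⟨u, hu⟩ := (hM v hv).2
      exact ⟨u, fun _ => hu⟩
    · exact ⟨v, fun h => absurd h hv⟩
  choose e he using this
  have hS : IsDoubleDomSet G (D ∪ M.image e) := by
    intro v
    by_cases hv : v ∈ M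
    · obtain ⟨⟨u, hu, huD⟩, _⟩ := hM v hv
      refine two_le_inter (u := u) (w := e v) (Finset.mem_union_left _ huD) hu
        (Finset.mem_union_right _ (Finset.mem_image_of_mem e hv)) (he v hv).1 ?_
      rintro rfl
      exact (he v hv).2 huD
    · exact (hD v hv).trans
        (Finset.card_le_card (Finset.inter_subset_inter_right Finset.subset_union_left))
  have h1 : doubleDomNum G ≤ (D ∪ M.image e).card := Nat.sInf_le ⟨_, hS, rfl⟩
  have h2 := Finset.card_union_le D (M.image e)
  have h3 := Finset.card_image_le (s := M) (f := e)
  omega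

lemma half [Fintype V] [DecidableEq V] [DecidableRel G.Adj] (c : V → Fin 4)
    (hc : ∀ v, Good G c v) (p : Fin 4 → Prop) [DecidablePred p]
    (h4 : ∃ x y, x ≠ y ∧ p x ∧ p y)
    (h3 : ∀ x y z, x ≠ y → x ≠ z → y ≠ z → (p x ∨ p y ∨ p z) ∧ (¬ p x ∨ ¬ p y ∨ ¬ p z)) :
    doubleDomNum G ≤ (Finset.univ.filter fun v => p (c v)).card +
      (Finset.univ.filter fun v => G.degree v = 2 ∧
        ¬ 2 ≤ ((Finset.univ.filter fun v => p (c v)) ∩ insert v (G.neighborFinset v)).card).card := by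
  have key : ∀ v, 2 ≤ ((Finset.univ.filter fun v => p (c v)) ∩
      insert v (G.neighborFinset v)).card ∨ (G.degree v = 2 ∧
      (∃ u ∈ insert v (G.neighborFinset v), p (c u)) ∧
      ∃ u ∈ insert v (G.neighborFinset v), ¬ p (c u)) := by
    intro v
    rcases hc v with hg | ⟨a, b, ha, hb, hall, hva, hvb, hab⟩
    · left
      obtain ⟨x, y, hxy, hx, hy⟩ := h4
      obtain ⟨u, hu, rfl⟩ := hg x
      obtain ⟨w, hw, rfl⟩ := hg y
      refine two_le_inter (u := u) (w := w) (by simpa using hx) (by simpa using hu)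
        (by simpa using hy) (by simpa using hw) ?_
      rintro rfl
      exact hxy rfl
    · right
      have hN : G.neighborFinset v = {a, b} := by
        ext u
        simp only [SimpleGraph.mem_neighborFinset, Finset.mem_insert, Finset.mem_singleton]
        constructor
        · exact hall u
        · rintro (rfl | rfl) <;> assumption
      have hne : a ≠ b := by rintro rfl; exact hab rfl
      refine ⟨?_, ?_, ?_⟩
      · rw [← SimpleGraph.card_neighborFinset_eq_degree, hN, Finset.card_pair hne]
      · rw [hN]
        have := (h3 _ _ _ hva hvb hab).1
        simpa using this
      · rw [hN]
        have := (h3 _ _ _ hva hvb hab).2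
        simpa using this
  apply repair
  · intro v hv
    simp only [Finset.mem_filter, Finset.mem_univ, true_and] at hv ⊢
    exact ((key v).resolve_left hv.2).2
  · intro v hv
    simp only [Finset.mem_filter, Finset.mem_univ, true_and, not_and, not_not] at hv
    rcases key v with h | h
    · exact h
    · exact hv h.1

end
end MOP

/-- For a maximal outerplanar graph on `n ≥ 3` vertices with `t`
vertices of degree 2, `γ×2(G) ≤ ⌊(n+t)/2⌋`. -/
theorem doubleDomNum_le_half_add {V : Type*} [Fintype V] [DecidableEq V]
    (G : SimpleGraph V) [DecidableRel G.Adj] (h : MaximalOuterplanar G)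
    (hn : 3 ≤ Fintype.card V) :
    doubleDomNum G ≤
      (Fintype.card V + (Finset.univ.filter fun v => G.degree v = 2).card) / 2 := by
  obtain ⟨c, hc⟩ := MOP.exists_colouring h hn
  have A := MOP.half c hc (fun x => x = 0 ∨ x = 1) (by decide) (by decide)
  have B := MOP.half c hc (fun x => ¬ (x = 0 ∨ x = 1)) (by decide)
    (by intro x y z h1 h2 h3; omega)
  have C := Finset.card_filter_add_card_filter_not (s := (Finset.univ : Finset V))
    (fun v => c v = 0 ∨ c v = 1)
  rw [Finset.card_univ] at C
  set D := Finset.univ.filter fun v => c v = 0 ∨ c v = 1 with hD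
  set D' := Finset.univ.filter fun v => ¬ (c v = 0 ∨ c v = 1) with hD'
  set M := Finset.univ.filter fun v => G.degree v = 2 ∧
    ¬ 2 ≤ (D ∩ insert v (G.neighborFinset v)).card with hM
  set M' := Finset.univ.filter fun v => G.degree v = 2 ∧
    ¬ 2 ≤ (D' ∩ insert v (G.neighborFinset v)).card with hM'
  have hdis : Disjoint M M' := by
    rw [Finset.disjoint_left]
    intro v hv hv'
    simp only [hM, hM', Finset.mem_filter, Finset.mem_univ, true_and] at hv hv'
    have h1 : (insert v (G.neighborFinset v)).card = 3 := by
      rw [Finset.card_insert_of_notMem (by simp), SimpleGraph.card_neighborFinset_eq_degree, hv.1]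
    have h2 : insert v (G.neighborFinset v) ⊆
        (D ∩ insert v (G.neighborFinset v)) ∪ (D' ∩ insert v (G.neighborFinset v)) := by
      intro u hu
      by_cases hu' : c u = 0 ∨ c u = 1
      · exact Finset.mem_union_left _ (Finset.mem_inter.2 ⟨by simp [hD, hu'], hu⟩)
      · exact Finset.mem_union_right _ (Finset.mem_inter.2
          ⟨Finset.mem_filter.2 ⟨Finset.mem_univ _, hu'⟩, hu⟩)
    have h3 := (Finset.card_le_card h2).trans (Finset.card_union_le _ _)
    omega
  have hle : M.card + M'.card ≤ (Finset.univ.filter fun v => G.degree v = 2).card := by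
    rw [← Finset.card_union_of_disjoint hdis]
    apply Finset.card_le_card
    intro v hv
    simp only [hM, hM', Finset.mem_union, Finset.mem_filter, Finset.mem_univ, true_and] at hv ⊢
    tauto
  omega
end

section
/- If G is a maximal outerplanar graph on n ≥ 4 vertices with t vertices of degree 2, then the set of all vertices of degree at least 3 is a double dominating set of G, and hence γ×2(G) ≤ n − t. -/
open SimpleGraph

section helpers

variable {V : Type*}

def CN (G : SimpleGraph V) (T : Set V) : Prop :=
  T.Nonempty ∧ ∀ A : Set V, (∃ x ∈ T, x ∈ A) →
    (∀ x ∈ T, x ∈ A → ∀ y ∈ T, G.Adj x y → y ∈ A) → ∀ y ∈ T, y ∈ A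

def Tch (G : SimpleGraph V) (P Q : Set V) : Prop := ∃ a ∈ P, ∃ b ∈ Q, G.Adj a b

def MD {W : Type*} (G : SimpleGraph V) (H : SimpleGraph W) (S : Set V) : Prop :=
  ∃ f : W → Set V, (∀ w, CN G (f w)) ∧ (∀ w, f w ⊆ S) ∧
    (∀ w₁ w₂, w₁ ≠ w₂ → ∀ x, x ∈ f w₁ → x ∈ f w₂ → False) ∧
    ∀ w₁ w₂, H.Adj w₁ w₂ → Tch G (f w₁) (f w₂)

abbrev K4 : SimpleGraph (Fin 4) := ⊤
abbrev K23 : SimpleGraph (Fin 2 ⊕ Fin 3) := completeBipartiteGraph (Fin 2) (Fin 3)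

def OP (G : SimpleGraph V) (S : Set V) : Prop := ¬ MD G K4 S ∧ ¬ MD G K23 S

theorem CN_iff (G : SimpleGraph V) (T : Set V) : (G.induce T).Connected ↔ CN G T := by
  constructor
  · intro h
    obtain ⟨⟨x, hx⟩⟩ := h.nonempty
    refine ⟨⟨x, hx⟩, ?_⟩
    rintro A ⟨u, huT, huA⟩ hc y hy
    obtain ⟨w⟩ := h.preconnected ⟨u, huT⟩ ⟨y, hy⟩
    have key : ∀ (p q : T) (_ : (G.induce T).Walk p q), (p : V) ∈ A → (q : V) ∈ A := by
      intro p q w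
      induction w with
      | nil => exact id
      | cons hadj _ ih =>
        intro hp
        exact ih (hc _ (Subtype.prop _) hp _ (Subtype.prop _) hadj)
    exact key _ _ w huA
  · rintro ⟨⟨x, hx⟩, h⟩
    have : Nonempty T := ⟨⟨x, hx⟩⟩
    refine SimpleGraph.Connected.mk ?_
    rintro ⟨p, hp⟩ ⟨q, hq⟩
    have := h {z | ∃ hz : z ∈ T, (G.induce T).Reachable ⟨p, hp⟩ ⟨z, hz⟩}
      ⟨p, hp, hp, SimpleGraph.Reachable.refl _⟩ (by
        rintro x hx ⟨_, hr⟩ y hy hxy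
        refine ⟨hy, hr.trans (SimpleGraph.Adj.reachable ?_)⟩
        exact hxy) q hq
    exact this.2

theorem hasMinor_iff {W : Type*} (G : SimpleGraph V) (H : SimpleGraph W) :
    HasMinor G H ↔ MD G H Set.univ := by
  constructor
  · rintro ⟨f, h1, h2, h3, h4⟩
    refine ⟨f, fun w => (CN_iff _ _).1 (h2 w), fun w => Set.subset_univ _, ?_, ?_⟩
    · intro a b hab x hx hy
      exact Set.disjoint_left.1 (h3 hab) hx hy
    · intro a b hab
      exact h4 hab
  · rintro ⟨f, h1, h2, h3, h4⟩
    refine ⟨f, fun w => (h1 w).1, fun w => (CN_iff _ _).2 (h1 w), ?_, ?_⟩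
    · intro a b hab
      exact Set.disjoint_left.2 fun x hx hy => h3 a b hab x hx hy
    · intro a b hab
      exact h4 a b hab

theorem outerplanar_iff (G : SimpleGraph V) : Outerplanar G ↔ OP G Set.univ := by
  unfold Outerplanar OP
  rw [hasMinor_iff, hasMinor_iff]

theorem CN_mono {G G' : SimpleGraph V} {T : Set V} (h : CN G' T)
    (hs : ∀ x ∈ T, ∀ y ∈ T, G'.Adj x y → G.Adj x y) : CN G T :=
  ⟨h.1, fun A hA hc => h.2 A hA fun x hx hxA y hy hxy => hc x hx hxA y hy (hs x hx y hy hxy)⟩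

theorem MD_mono {W : Type*} {G G' : SimpleGraph V} {H : SimpleGraph W} {S T : Set V}
    (hs : ∀ x ∈ S, ∀ y ∈ S, G'.Adj x y → G.Adj x y) (hST : S ⊆ T) (h : MD G' H S) :
    MD G H T := by
  obtain ⟨f, h1, h2, h3, h4⟩ := h
  refine ⟨f, fun w => CN_mono (h1 w) fun x hx y hy => hs x (h2 w hx) y (h2 w hy),
    fun w => (h2 w).trans hST, h3, ?_⟩
  intro a b hab
  obtain ⟨x, hx, y, hy, hxy⟩ := h4 a b hab
  exact ⟨x, hx, y, hy, hs x (h2 _ hx) y (h2 _ hy) hxy⟩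

theorem OP_mono {G G' : SimpleGraph V} {S T : Set V}
    (hs : ∀ x ∈ S, ∀ y ∈ S, G'.Adj x y → G.Adj x y) (hST : S ⊆ T) (h : OP G T) : OP G' S :=
  ⟨fun h' => h.1 (MD_mono hs hST h'), fun h' => h.2 (MD_mono hs hST h')⟩

theorem Tch.symm {G : SimpleGraph V} {P Q : Set V} (h : Tch G P Q) : Tch G Q P := by
  obtain ⟨a, ha, b, hb, hab⟩ := h
  exact ⟨b, hb, a, ha, hab.symm⟩

theorem Tch.mono {G : SimpleGraph V} {P Q P' Q' : Set V} (h : Tch G P Q) (hP : P ⊆ P')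
    (hQ : Q ⊆ Q') : Tch G P' Q' := by
  obtain ⟨a, ha, b, hb, hab⟩ := h
  exact ⟨a, hP ha, b, hQ hb, hab⟩

theorem CN_singleton (G : SimpleGraph V) (a : V) : CN G {a} := by
  refine ⟨⟨a, rfl⟩, ?_⟩
  rintro A ⟨x, hx, hxA⟩ _ y hy
  rw [Set.mem_singleton_iff] at hx hy
  subst hx; subst hy; exact hxA

theorem CN_union {G : SimpleGraph V} {P Q : Set V} (hP : CN G P) (hQ : CN G Q)
    (h : Tch G P Q) : CN G (P ∪ Q) := by
  refine ⟨hP.1.mono Set.subset_union_left, ?_⟩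
  rintro A ⟨x, hx, hxA⟩ hc
  obtain ⟨p, hp, q, hq, hpq⟩ := h
  have hPc := hP.2 A
  have hQc := hQ.2 A
  have e1 : (∃ x ∈ P, x ∈ A) → ∀ y ∈ P, y ∈ A := fun h => hPc h
    fun x hx hxA y hy hxy => hc x (Or.inl hx) hxA y (Or.inl hy) hxy
  have e2 : (∃ x ∈ Q, x ∈ A) → ∀ y ∈ Q, y ∈ A := fun h => hQc h
    fun x hx hxA y hy hxy => hc x (Or.inr hx) hxA y (Or.inr hy) hxy
  have f1 : p ∈ A → q ∈ A := fun h => hc p (Or.inl hp) h q (Or.inr hq) hpq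
  have f2 : q ∈ A → p ∈ A := fun h => hc q (Or.inr hq) h p (Or.inl hp) hpq.symm
  rintro y (hy | hy) <;> rcases hx with hx | hx
  · exact e1 ⟨x, hx, hxA⟩ y hy
  · exact e1 ⟨p, hp, f2 (e2 ⟨x, hx, hxA⟩ q hq)⟩ y hy
  · exact e2 ⟨q, hq, f1 (e1 ⟨x, hx, hxA⟩ p hp)⟩ y hy
  · exact e2 ⟨x, hx, hxA⟩ y hy

/-- Component of `x` inside `T`. -/
def compIn (G : SimpleGraph V) (T : Set V) (x : V) : Set V :=
  {y | Relation.ReflTransGen (fun p q => q ∈ T ∧ G.Adj p q) x y}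

theorem self_cmp (G : SimpleGraph V) (T : Set V) (x : V) : x ∈ compIn G T x :=
  Relation.ReflTransGen.refl

theorem cmp_sub {G : SimpleGraph V} {T : Set V} {x : V} (hx : x ∈ T) : compIn G T x ⊆ T := by
  intro y hy
  induction hy with
  | refl => exact hx
  | tail _ h _ => exact h.1

theorem cmp_closed {G : SimpleGraph V} {T : Set V} {x y z : V} (hy : y ∈ compIn G T x)
    (hz : z ∈ T) (h : G.Adj y z) : z ∈ compIn G T x :=
  Relation.ReflTransGen.tail hy ⟨hz, h⟩

theorem cmp_symm {G : SimpleGraph V} {T : Set V} {x y : V} (hx : x ∈ T)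
    (hy : y ∈ compIn G T x) : x ∈ compIn G T y := by
  induction hy with
  | refl => exact self_cmp _ _ _
  | @tail b c hb h ih =>
    exact Relation.ReflTransGen.head ⟨cmp_sub hx hb, h.2.symm⟩ ih

theorem cmp_trans {G : SimpleGraph V} {T : Set V} {x y z : V}
    (hy : y ∈ compIn G T x) (hz : z ∈ compIn G T y) : z ∈ compIn G T x :=
  Relation.ReflTransGen.trans hy hz

theorem cmp_CN {G : SimpleGraph V} {T : Set V} {x : V} (hx : x ∈ T) : CN G (compIn G T x) := by
  refine ⟨⟨x, self_cmp _ _ _⟩, ?_⟩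
  rintro A ⟨u, hu, huA⟩ hc
  have main : ∀ p ∈ compIn G T x, p ∈ A → ∀ q ∈ compIn G T p, q ∈ A := by
    intro p hp hpA q hq
    induction hq with
    | refl => exact hpA
    | @tail b c hb h ih =>
      exact hc b (cmp_trans hp hb) ih c (cmp_closed (cmp_trans hp hb) h.1 h.2) h.2
  have hxA := main u hu huA x (cmp_symm hx hu)
  exact fun y hy => main x (self_cmp _ _ _) hxA y hy

theorem CN_sub_cmp {G : SimpleGraph V} {T R : Set V} {x y : V} (hR : CN G R) (hRT : R ⊆ T)
    (hy : y ∈ R) (hyx : y ∈ compIn G T x) : R ⊆ compIn G T x :=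
  hR.2 _ ⟨y, hy, hyx⟩ fun _ _ hpA _ hq hpq => cmp_closed hpA (hRT hq) hpq

theorem MD_K4_of {G : SimpleGraph V} {S A B C D : Set V}
    (hA : CN G A) (hB : CN G B) (hC : CN G C) (hD : CN G D)
    (sA : A ⊆ S) (sB : B ⊆ S) (sC : C ⊆ S) (sD : D ⊆ S)
    (dAB : Disjoint A B) (dAC : Disjoint A C) (dAD : Disjoint A D)
    (dBC : Disjoint B C) (dBD : Disjoint B D) (dCD : Disjoint C D)
    (tAB : Tch G A B) (tAC : Tch G A C) (tAD : Tch G A D)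
    (tBC : Tch G B C) (tBD : Tch G B D) (tCD : Tch G C D) : MD G K4 S := by
  rw [Set.disjoint_left] at *
  refine ⟨![A, B, C, D], ?_, ?_, ?_, ?_⟩
  · intro w; fin_cases w <;> assumption
  · intro w; fin_cases w <;> assumption
  · intro i j hij x
    fin_cases i <;> fin_cases j <;> first | exact absurd rfl hij | skip
    · exact fun h1 h2 => dAB h1 h2
    · exact fun h1 h2 => dAC h1 h2
    · exact fun h1 h2 => dAD h1 h2
    · exact fun h1 h2 => dAB h2 h1
    · exact fun h1 h2 => dBC h1 h2
    · exact fun h1 h2 => dBD h1 h2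
    · exact fun h1 h2 => dAC h2 h1
    · exact fun h1 h2 => dBC h2 h1
    · exact fun h1 h2 => dCD h1 h2
    · exact fun h1 h2 => dAD h2 h1
    · exact fun h1 h2 => dBD h2 h1
    · exact fun h1 h2 => dCD h2 h1
  · intro i j hij
    fin_cases i <;> fin_cases j <;>
      first | exact absurd rfl hij.ne | assumption | (apply Tch.symm; assumption)

theorem MD_K23_of {G : SimpleGraph V} {S A B X Y Z : Set V}
    (hA : CN G A) (hB : CN G B) (hX : CN G X) (hY : CN G Y) (hZ : CN G Z)
    (sA : A ⊆ S) (sB : B ⊆ S) (sX : X ⊆ S) (sY : Y ⊆ S) (sZ : Z ⊆ S)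
    (dAB : Disjoint A B) (dAX : Disjoint A X) (dAY : Disjoint A Y) (dAZ : Disjoint A Z)
    (dBX : Disjoint B X) (dBY : Disjoint B Y) (dBZ : Disjoint B Z)
    (dXY : Disjoint X Y) (dXZ : Disjoint X Z) (dYZ : Disjoint Y Z)
    (tAX : Tch G A X) (tAY : Tch G A Y) (tAZ : Tch G A Z)
    (tBX : Tch G B X) (tBY : Tch G B Y) (tBZ : Tch G B Z) : MD G K23 S := by
  rw [Set.disjoint_left] at *
  refine ⟨Sum.elim ![A, B] ![X, Y, Z], ?_, ?_, ?_, ?_⟩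
  · rintro (w | w) <;> fin_cases w <;> assumption
  · rintro (w | w) <;> fin_cases w <;> assumption
  · have key : ∀ {P Q : Set V}, (∀ ⦃a⦄, a ∈ P → a ∉ Q) → ∀ x, x ∈ Q → x ∈ P → False :=
      fun h x h1 h2 => h h2 h1
    rintro (i | i) (j | j) hij <;> fin_cases i <;> fin_cases j <;>
      first | exact absurd rfl hij | assumption | (apply key; assumption)
  · rintro (i | i) (j | j) hij
    · simp at hij
    · fin_cases i <;> fin_cases j <;> assumption
    · fin_cases i <;> fin_cases j <;> (apply Tch.symm; assumption)
    · simp at hij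

/-- Removing a vertex `v` whose neighbours in `S` are within an edge `ab` (or one vertex). -/
theorem remove_vertex {W : Type*} {G : SimpleGraph V} {H : SimpleGraph W} {S : Set V}
    {v a b : V} (hN : ∀ x ∈ S, G.Adj v x → x = a ∨ x = b)
    (hab : a = b ∨ G.Adj a b) {f : W → Set V} (h1 : ∀ w, CN G (f w))
    (h2 : ∀ w, f w ⊆ insert v S)
    (h3 : ∀ w₁ w₂, w₁ ≠ w₂ → ∀ x, x ∈ f w₁ → x ∈ f w₂ → False)
    (h4 : ∀ w₁ w₂, H.Adj w₁ w₂ → Tch G (f w₁) (f w₂))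
    (hne : ∀ w, f w ≠ {v}) : MD G H S := by
  have hN' : ∀ w, ∀ x ∈ f w, G.Adj v x → x = a ∨ x = b := by
    intro w x hx hvx
    rcases h2 w hx with h | h
    · exact absurd h hvx.ne'
    · exact hN x h hvx
  have hab' : ∀ w w', ∀ x ∈ f w, ∀ y ∈ f w', G.Adj v x → G.Adj v y → x = y ∨ G.Adj x y := by
    intro w w' x hx y hy hvx hvy
    have := hN' w x hx hvx
    have := hN' w' y hy hvy
    have := hab
    have := G.symm
    grind [SimpleGraph.adj_comm]
  have hother : ∀ w, ∃ x ∈ f w, x ≠ v := by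
    intro w
    by_contra hcon
    push Not at hcon
    obtain ⟨z, hz⟩ := (h1 w).1
    apply hne w
    ext y
    constructor
    · exact fun hy => hcon y hy
    · rintro rfl
      rw [← hcon z hz]; exact hz
  have hnbr : ∀ w, v ∈ f w → ∃ z ∈ f w, G.Adj v z := by
    intro w hv
    by_contra hcon
    push Not at hcon
    obtain ⟨x, hx, hxv⟩ := hother w
    exact hxv ((h1 w).2 {v} ⟨v, hv, rfl⟩ (by
      intro p hp hpv q hq hpq
      rw [Set.mem_singleton_iff] at hpv
      subst hpv
      exact absurd hpq (hcon q hq)) x hx)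
  refine ⟨fun w => f w \ {v}, ?_, ?_, ?_, ?_⟩
  · intro w
    obtain ⟨x, hx, hxv⟩ := hother w
    refine ⟨⟨x, hx, hxv⟩, ?_⟩
    rintro A ⟨u, hu, huA⟩ hc y hy
    have := (h1 w).2 {z | (z ≠ v ∧ z ∈ A) ∨ (z = v ∧ ∃ s ∈ f w, s ∈ A ∧ s ≠ v ∧ G.Adj v s)}
      ⟨u, hu.1, Or.inl ⟨hu.2, huA⟩⟩ (by
        rintro p hp (⟨hpv, hpA⟩ | ⟨rfl, s, hs, hsA, hsv, hvs⟩) q hq hpq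
        · by_cases hqv : q = v
          · subst hqv
            exact Or.inr ⟨rfl, p, hp, hpA, hpv, hpq.symm⟩
          · exact Or.inl ⟨hqv, hc p ⟨hp, hpv⟩ hpA q ⟨hq, hqv⟩ hpq⟩
        · left
          refine ⟨hpq.ne', ?_⟩
          rcases hab' w w s hs q hq hvs hpq with h | h
          · exact h ▸ hsA
          · exact hc s ⟨hs, hsv⟩ hsA q ⟨hq, hpq.ne'⟩ h) y hy.1
    rcases this with h | h
    · exact h.2
    · exact absurd h.1 hy.2
  · rintro w x ⟨hx, hxv⟩
    rcases h2 w hx with h | h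
    · exact absurd h hxv
    · exact h
  · intro w w' hww x hx hx'
    exact h3 w w' hww x hx.1 hx'.1
  · intro w w' hww
    have key : ∀ w w', w ≠ w' → ∀ q ∈ f w', v ∈ f w → G.Adj v q →
        Tch G (f w \ {v}) (f w' \ {v}) := by
      intro w w' hww q hq hv hvq
      obtain ⟨z, hz, hvz⟩ := hnbr w hv
      refine ⟨z, ⟨hz, hvz.ne'⟩, q, ⟨hq, hvq.ne'⟩, ?_⟩
      rcases hab' w w' z hz q hq hvz hvq with h | h
      · subst h; exact (h3 w w' hww z hz hq).elim
      · exact h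
    obtain ⟨p, hp, q, hq, hpq⟩ := h4 w w' hww
    by_cases hpv : p = v
    · subst hpv
      exact key w w' hww.ne q hq hp hpq
    · by_cases hqv : q = v
      · subst hqv
        exact (key w' w hww.ne' p hp hq hpq.symm).symm
      · exact ⟨p, ⟨hp, hpv⟩, q, ⟨hq, hqv⟩, hpq⟩

/-- Adding a vertex with at most one neighbour. -/
theorem OP_leaf {G : SimpleGraph V} {S : Set V} {v a : V} 
    (hN : ∀ x ∈ S, G.Adj v x → x = a) (h : OP G S) : OP G (insert v S) := by
  have key : ∀ {W : Type} (H : SimpleGraph W),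
      (∀ w, ∃ w₁ w₂, w₁ ≠ w₂ ∧ H.Adj w w₁ ∧ H.Adj w w₂) → MD G H (insert v S) → MD G H S := by
    rintro W H hH ⟨f, h1, h2, h3, h4⟩
    refine remove_vertex (a := a) (b := a) (fun x hx hvx => Or.inl (hN x hx hvx)) (Or.inl rfl)
      h1 h2 h3 h4 ?_
    intro w hw
    obtain ⟨w₁, w₂, hne, e1, e2⟩ := hH w
    have aux : ∀ w', H.Adj w w' → a ∈ f w' := by
      intro w' e
      obtain ⟨p, hp, q, hq, hpq⟩ := h4 w w' e
      rw [hw, Set.mem_singleton_iff] at hp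
      subst hp
      rcases h2 w' hq with h | h
      · exact absurd h hpq.ne'
      · rw [← hN q h hpq]; exact hq
    exact h3 _ _ hne a (aux _ e1) (aux _ e2)
  refine ⟨fun hm => h.1 (key _ ?_ hm), fun hm => h.2 (key _ ?_ hm)⟩
  · decide
  · rintro (w | w)
    · exact ⟨Sum.inr 0, Sum.inr 1, by decide, by simp, by simp⟩
    · exact ⟨Sum.inl 0, Sum.inl 1, by decide, by simp, by simp⟩

/-- Adding a vertex on an edge: the only obstruction is a `K23` with singleton bag `{v}`. -/
theorem OP_ear {G : SimpleGraph V} {S : Set V} {v a b : V} 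
    (hN : ∀ x ∈ S, G.Adj v x → x = a ∨ x = b) (hab : G.Adj a b) (h : OP G S)
    (hbad : ∀ A B X Y : Set V, CN G A → CN G B → CN G X → CN G Y →
      A ⊆ S → B ⊆ S → X ⊆ S → Y ⊆ S → Disjoint A B → Disjoint A X → Disjoint A Y →
      Disjoint B X → Disjoint B Y → Disjoint X Y → Tch G A X → Tch G A Y → Tch G B X →
      Tch G B Y → a ∈ A → b ∈ B → False) : OP G (insert v S) := by
  have aux : ∀ {W : Type} (H : SimpleGraph W) (f : W → Set V), (∀ w, f w ⊆ insert v S) → 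
      (∀ w₁ w₂, H.Adj w₁ w₂ → Tch G (f w₁) (f w₂)) → ∀ w w', f w = {v} → H.Adj w w' →
        a ∈ f w' ∨ b ∈ f w' := by
    intro W H f h2 h4 w w' hw e
    obtain ⟨p, hp, q, hq, hpq⟩ := h4 w w' e
    rw [hw, Set.mem_singleton_iff] at hp
    subst hp
    rcases h2 w' hq with h | h
    · exact absurd h hpq.ne'
    · rcases hN q h hpq with rfl | rfl
      · exact Or.inl hq
      · exact Or.inr hq
  have three : ∀ {W : Type} (H : SimpleGraph W) (f : W → Set V), (∀ w, f w ⊆ insert v S) → 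
      (∀ w₁ w₂, w₁ ≠ w₂ → ∀ x, x ∈ f w₁ → x ∈ f w₂ → False) →
      (∀ w₁ w₂, H.Adj w₁ w₂ → Tch G (f w₁) (f w₂)) → ∀ w x y z, f w = {v} → H.Adj w x →
        H.Adj w y → H.Adj w z → x ≠ y → x ≠ z → y ≠ z → False := by
    intro W H f h2 h3 h4 w x y z hw ex ey ez hxy hxz hyz
    have := aux H f h2 h4 w x hw ex
    have := aux H f h2 h4 w y hw ey
    have := aux H f h2 h4 w z hw ez
    have := h3 x y hxy
    have := h3 x z hxz
    have := h3 y z hyz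
    grind
  constructor
  · rintro ⟨f, h1, h2, h3, h4⟩
    refine h.1 (remove_vertex hN (Or.inr hab) h1 h2 h3 h4 ?_)
    intro w hw
    have hd : ∀ w : Fin 4, ∃ x y z, K4.Adj w x ∧ K4.Adj w y ∧ K4.Adj w z ∧ x ≠ y ∧ x ≠ z ∧ y ≠ z := by
      decide
    obtain ⟨x, y, z, e1, e2, e3, n1, n2, n3⟩ := hd w
    exact three K4 f h2 h3 h4 w x y z hw e1 e2 e3 n1 n2 n3
  · rintro ⟨f, h1, h2, h3, h4⟩
    refine h.2 (remove_vertex hN (Or.inr hab) h1 h2 h3 h4 ?_)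
    rintro (w | w) hw
    · exact three K23 f h2 h3 h4 _ (Sum.inr 0) (Sum.inr 1) (Sum.inr 2) hw (by simp) (by simp)
        (by simp) (by decide) (by decide) (by decide)
    · have hd : ∀ w : Fin 3, ∃ x y : Fin 3, x ≠ w ∧ y ≠ w ∧ x ≠ y := by decide
      obtain ⟨x, y, nx, ny, nxy⟩ := hd w
      have hs : ∀ u, u ≠ Sum.inr w → f u ⊆ S := by
        intro u hu p hp
        rcases h2 u hp with h | h
        · exact (h3 u _ hu p hp (by rw [hw]; exact h)).elim
        · exact h
      have d : ∀ u u', u ≠ u' → Disjoint (f u) (f u') := fun u u' huu =>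
        Set.disjoint_left.2 fun p hp hq => h3 u u' huu p hp hq
      have fin : ∀ i j : Fin 2, i ≠ j → a ∈ f (Sum.inl i) → b ∈ f (Sum.inl j) → False := by
        intro i j hij ha hb
        exact hbad (f (Sum.inl i)) (f (Sum.inl j)) (f (Sum.inr x)) (f (Sum.inr y))
          (h1 _) (h1 _) (h1 _) (h1 _) (hs _ (by simp)) (hs _ (by simp)) (hs _ (by simpa))
          (hs _ (by simpa)) (d _ _ (by simpa)) (d _ _ (by simp)) (d _ _ (by simp))
          (d _ _ (by simp)) (d _ _ (by simp)) (d _ _ (by simpa)) (h4 _ _ (by simp))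
          (h4 _ _ (by simp)) (h4 _ _ (by simp)) (h4 _ _ (by simp)) ha hb
      rcases aux K23 f h2 h4 _ (Sum.inl 0) hw (by simp) with p0 | p0 <;>
      rcases aux K23 f h2 h4 _ (Sum.inl 1) hw (by simp) with p1 | p1
      · exact h3 _ _ (by decide) _ p0 p1
      · exact fin 0 1 (by decide) p0 p1
      · exact fin 1 0 (by decide) p1 p0
      · exact h3 _ _ (by decide) _ p0 p1

def Good (G : SimpleGraph V) (S : Set V) (a b : V) : Prop :=
  ∀ p ∈ S \ {a, b}, ∀ q ∈ S \ {a, b},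
    Tch G {a} (compIn G (S \ {a, b}) p) → Tch G {b} (compIn G (S \ {a, b}) p) →
    Tch G {a} (compIn G (S \ {a, b}) q) → Tch G {b} (compIn G (S \ {a, b}) q) →
    q ∈ compIn G (S \ {a, b}) p

theorem exists_good [Finite V] {G : SimpleGraph V} {S : Set V} {a b₀ : V} (hb : b₀ ∈ S)
    (hab : G.Adj a b₀) : ∃ b ∈ S, G.Adj a b ∧ Good G S a b := by
  by_contra hcon
  push Not at hcon
  have main : ∀ n : ℕ, ∀ b ∈ S, G.Adj a b → ∀ p ∈ S \ {a, b},
      Tch G {a} (compIn G (S \ {a, b}) p) → 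
      (compIn G (S \ {a, b}) p).ncard = n → False := by
    intro n
    induction n using Nat.strong_induction_on with
    | _ n ih =>
      intro b hb hab p hp ht hn
      obtain ⟨a', ha', c, hc, hac⟩ := ht
      rw [Set.mem_singleton_iff] at ha'
      subst ha'
      have hcT := cmp_sub hp hc
      have hbad := hcon c hcT.1 hac
      unfold Good at hbad
      push Not at hbad
      obtain ⟨p', hp', q', hq', t1, t2, t3, t4, hne⟩ := hbad
      have fin : ∀ r ∈ S \ {a', c}, Tch G {a'} (compIn G (S \ {a', c}) r) →
          Tch G {c} (compIn G (S \ {a', c}) r) → b ∉ compIn G (S \ {a', c}) r → False := by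
        intro r hr u1 u2 hbr
        have hsub := cmp_sub (G := G) hr
        have hsub2 : {c} ∪ compIn G (S \ {a', c}) r ⊆ compIn G (S \ {a', b}) p := by
          refine CN_sub_cmp (CN_union (CN_singleton G c) (cmp_CN hr) u2) ?_ (Or.inl rfl) hc
          rintro x (hx | hx)
          · rw [Set.mem_singleton_iff] at hx
            subst hx; exact hcT
          · have := hsub hx
            have h1 : x ≠ b := fun h => hbr (h ▸ hx)
            simp_all
        refine ih _ ?_ c hcT.1 hac r hr u1 rfl
        rw [← hn]
        refine Set.ncard_lt_ncard ?_ (Set.toFinite _)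
        refine ⟨fun x hx => hsub2 (Or.inr hx), fun hh => ?_⟩
        have := hsub (hh hc)
        simp at this
      by_cases hbp : b ∈ compIn G (S \ {a', c}) p'
      · refine fin q' hq' t3 t4 fun hbq => hne ?_
        exact cmp_trans hbp (cmp_symm hq' hbq)
      · exact fin p' hp' t1 t2 hbp
  have hbad := hcon b₀ hb hab
  unfold Good at hbad
  push Not at hbad
  obtain ⟨p', hp', q', hq', t1, t2, t3, t4, hne⟩ := hbad
  exact main _ b₀ hb hab p' hp' t1 rfl

theorem good_of_small {G : SimpleGraph V} {S : Set V} {a b c : V}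
    (hN : ∀ x ∈ S, G.Adj a x → x = b ∨ x = c) : Good G S a b := by
  have key : ∀ p ∈ S \ {a, b}, Tch G {a} (compIn G (S \ {a, b}) p) → c ∈ compIn G (S \ {a, b}) p := by
    rintro p hp ⟨a', ha', x, hx, hax⟩
    rw [Set.mem_singleton_iff] at ha'
    subst ha'
    have := cmp_sub hp hx
    rcases hN x this.1 hax with rfl | rfl
    · simp at this
    · exact hx
  intro p hp q hq t1 _ t3 _
  exact cmp_trans (key p hp t1) (cmp_symm hq (key q hq t3))

/-- The splitting lemma. -/
theorem split {G : SimpleGraph V} {F X Y : Set V} {a : V} (hF : CN G F) (ha : a ∈ F)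
    (hX : CN G X) (hY : CN G Y) (dFX : Disjoint F X) (dFY : Disjoint F Y) (dXY : Disjoint X Y)
    (tX : Tch G F X) (tY : Tch G F Y) :
    (∃ Z ⊆ F \ {a}, CN G Z ∧ Tch G {a} Z ∧ Tch G Z X ∧ Tch G Z Y) ∨
    ∃ X' Y', X ⊆ X' ∧ Y ⊆ Y' ∧ X' ⊆ (F \ {a}) ∪ X ∧ Y' ⊆ (F \ {a}) ∪ Y ∧ CN G X' ∧ CN G Y' ∧
      Disjoint X' Y' ∧ Tch G {a} X' ∧ Tch G {a} Y' := by
  have ta : ∀ z ∈ F \ {a}, Tch G {a} (compIn G (F \ {a}) z) := by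
    intro z hz
    by_contra hcon
    have := hF.2 (compIn G (F \ {a}) z) ⟨z, hz.1, self_cmp _ _ _⟩ (by
      intro x hx hxc y hy hxy
      by_cases hya : y = a
      · subst hya
        exact (hcon ⟨y, rfl, x, hxc, hxy.symm⟩).elim
      · exact cmp_closed hxc ⟨hy, hya⟩ hxy) a ha
    exact (cmp_sub hz this).2 rfl
  by_cases hz : ∃ z ∈ F \ {a}, Tch G (compIn G (F \ {a}) z) X ∧ Tch G (compIn G (F \ {a}) z) Y
  · left
    obtain ⟨z, hz, h1, h2⟩ := hz
    exact ⟨_, cmp_sub hz, cmp_CN hz, ta z hz, h1, h2⟩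
  · right
    have key : ∀ X : Set V, CN G X → Disjoint F X → Tch G F X →
        CN G (X ∪ {z | z ∈ F \ {a} ∧ Tch G (compIn G (F \ {a}) z) X}) ∧
        Tch G {a} (X ∪ {z | z ∈ F \ {a} ∧ Tch G (compIn G (F \ {a}) z) X}) := by
      intro X hX dX tX
      have hcc : ∀ z ∈ F \ {a}, Tch G (compIn G (F \ {a}) z) X → compIn G (F \ {a}) z ⊆
          (X ∪ {z | z ∈ F \ {a} ∧ Tch G (compIn G (F \ {a}) z) X}) := by
        intro z hz ht y hy
        refine Or.inr ⟨cmp_sub hz hy, ht.mono (fun u hu => ?_) subset_rfl⟩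
        exact cmp_trans (cmp_symm hz hy) hu
      constructor
      · refine ⟨hX.1.mono Set.subset_union_left, ?_⟩
        rintro A ⟨u, hu, huA⟩ hc
        have hXA : (∃ x ∈ X, x ∈ A) → ∀ x ∈ X, x ∈ A := fun h => hX.2 A h
          fun x hx hxA y hy hxy => hc x (Or.inl hx) hxA y (Or.inl hy) hxy
        have hCA : ∀ z ∈ F \ {a}, Tch G (compIn G (F \ {a}) z) X →
            (∃ x ∈ compIn G (F \ {a}) z, x ∈ A) → ∀ x ∈ compIn G (F \ {a}) z, x ∈ A := 
          fun z hz ht h => (cmp_CN hz).2 A h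
            fun x hx hxA y hy hxy => hc x (hcc z hz ht hx) hxA y (hcc z hz ht hy) hxy
        have hXall : ∀ x ∈ X, x ∈ A := by
          rcases hu with hu | ⟨hu, ht⟩
          · exact hXA ⟨u, hu, huA⟩
          · obtain ⟨p, hp, x, hx, hpx⟩ := id ht
            have := hCA u hu ht ⟨u, self_cmp _ _ _, huA⟩ p hp
            exact hXA ⟨x, hx, hc p (hcc u hu ht hp) this x (Or.inl hx) hpx⟩
        rintro y (hy | ⟨hy, ht⟩)
        · exact hXall y hy
        · obtain ⟨p, hp, x, hx, hpx⟩ := id ht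
          exact hCA y hy ht ⟨p, hp, hc x (Or.inl hx) (hXall x hx) p (hcc y hy ht hp) hpx.symm⟩ y
            (self_cmp _ _ _)
      · obtain ⟨p, hp, x, hx, hpx⟩ := tX
        by_cases hpa : p = a
        · subst hpa
          exact ⟨p, rfl, x, Or.inl hx, hpx⟩
        · have hpF : p ∈ F \ {a} := ⟨hp, hpa⟩
          exact (ta p hpF).mono subset_rfl (hcc p hpF ⟨p, self_cmp _ _ _, x, hx, hpx⟩)
    obtain ⟨x1, x2⟩ := key X hX dFX tX
    obtain ⟨y1, y2⟩ := key Y hY dFY tY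
    refine ⟨_, _, Set.subset_union_left, Set.subset_union_left, ?_, ?_, x1, y1, ?_, x2, y2⟩
    · rintro x (h | h)
      · exact Or.inr h
      · exact Or.inl h.1
    · rintro x (h | h)
      · exact Or.inr h
      · exact Or.inl h.1
    · rw [Set.disjoint_left] at *
      rintro x (h | h) (h' | h')
      · exact dXY h h'
      · exact dFX h'.1.1 h
      · exact dFY h.1.1 h'
      · exact hz ⟨x, h.1, h.2, h'.2⟩

theorem good_core {G : SimpleGraph V} {S : Set V} {a b : V} (hab : G.Adj a b) (haS : a ∈ S)
    (hbS : b ∈ S) (h : OP G S) (hg : Good G S a b) {X Y : Set V} (hX : CN G X) (hY : CN G Y)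
    (sX : X ⊆ S \ {a, b}) (sY : Y ⊆ S \ {a, b}) (d : Disjoint X Y)
    (aX : Tch G {a} X) (aY : Tch G {a} Y) (bX : Tch G {b} X) (bY : Tch G {b} Y) : False := by
  obtain ⟨p, hp⟩ := hX.1
  obtain ⟨q, hq⟩ := hY.1
  have cX := CN_sub_cmp hX sX hp (self_cmp G _ p)
  have cY := CN_sub_cmp hY sY hq (self_cmp G _ q)
  have hqp := hg p (sX hp) q (sY hq) (aX.mono subset_rfl cX) (bX.mono subset_rfl cX)
    (aY.mono subset_rfl cY) (bY.mono subset_rfl cY)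
  have hpT : p ∈ (S \ {a, b}) \ Y := ⟨sX hp, Set.disjoint_left.1 d hp⟩
  set P := compIn G ((S \ {a, b}) \ Y) p with hP
  have hPs : P ⊆ (S \ {a, b}) \ Y := cmp_sub hpT
  have hXP : X ⊆ P := CN_sub_cmp hX
    (fun x hx => ⟨sX hx, Set.disjoint_left.1 d hx⟩) hp (self_cmp _ _ _)
  have tPY : Tch G P Y := by
    by_contra hcon
    have := (cmp_CN (G := G) (sX hp)).2 P ⟨p, self_cmp _ _ _, self_cmp _ _ _⟩ (by
      intro x hx hxP y hy hxy
      by_cases hyY : y ∈ Y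
      · exact (hcon ⟨x, hxP, y, hyY, hxy⟩).elim
      · exact cmp_closed hxP ⟨cmp_sub (sX hp) hy, hyY⟩ hxy) q hqp
    exact (hPs this).2 hq
  refine h.1 (MD_K4_of (CN_singleton G a) (CN_singleton G b) (cmp_CN hpT) hY ?_ ?_
    (fun x hx => (hPs hx).1.1) (fun x hx => (sY hx).1) ?_ ?_ ?_ ?_ ?_ ?_ ⟨a, rfl, b, rfl, hab⟩
    (aX.mono subset_rfl hXP) aY (bX.mono subset_rfl hXP) bY tPY)
  · simpa using haS
  · simpa using hbS
  · simpa using hab.ne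
  · exact Set.disjoint_singleton_left.2 fun hx => (hPs hx).1.2 (by simp)
  · exact Set.disjoint_singleton_left.2 fun hx => (sY hx).2 (by simp)
  · exact Set.disjoint_singleton_left.2 fun hx => (hPs hx).1.2 (by simp)
  · exact Set.disjoint_singleton_left.2 fun hx => (sY hx).2 (by simp)
  · exact Set.disjoint_left.2 fun x hx => (hPs hx).2

theorem OP_good {G : SimpleGraph V} {S : Set V} {v a b : V} 
    (hN : ∀ x ∈ S, G.Adj v x → x = a ∨ x = b) (hab : G.Adj a b) (h : OP G S)
    (hg : Good G S a b) : OP G (insert v S) := by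
  refine OP_ear hN hab h ?_
  intro A B X Y hA hB hX hY sA sB sX sY dAB dAX dAY dBX dBY dXY tAX tAY tBX tBY ha hb
  rcases split hA ha hX hY dAX dAY dXY tAX tAY with
    ⟨Z, sZ, hZ, taZ, tZX, tZY⟩ | ⟨X', Y', sX', sY', sX2, sY2, hX', hY', d', taX, taY⟩
  · have sZA : Z ⊆ A := fun x hx => (sZ hx).1
    refine h.2 (MD_K23_of hZ hB hX hY (CN_singleton G a) (sZA.trans sA) sB sX sY ?_
      (dAB.mono_left sZA) (dAX.mono_left sZA) (dAY.mono_left sZA) ?_ dBX dBY ?_ dXY ?_ ?_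
      tZX tZY taZ.symm tBX tBY ⟨b, hb, a, rfl, hab.symm⟩)
    · simpa using sA ha
    · exact Set.disjoint_singleton_right.2 fun hx => (sZ hx).2 rfl
    · exact Set.disjoint_singleton_right.2 fun hx => Set.disjoint_left.1 dAB ha hx
    · exact Set.disjoint_singleton_right.2 fun hx => Set.disjoint_left.1 dAX ha hx
    · exact Set.disjoint_singleton_right.2 fun hx => Set.disjoint_left.1 dAY ha hx
  · rw [Set.disjoint_left] at *
    have haX' : a ∉ X' := fun hx => by
      rcases sX2 hx with h | h
      · exact h.2 rfl
      · exact dAX ha h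
    have haY' : a ∉ Y' := fun hx => by
      rcases sY2 hx with h | h
      · exact h.2 rfl
      · exact dAY ha h
    have dBX' : ∀ x, x ∈ B → x ∉ X' := fun x hB hx => by
      rcases sX2 hx with h | h
      · exact dAB h.1 hB
      · exact dBX hB h
    have dBY' : ∀ x, x ∈ B → x ∉ Y' := fun x hB hx => by
      rcases sY2 hx with h | h
      · exact dAB h.1 hB
      · exact dBY hB h
    have sXS : X' ⊆ S := fun x hx => by
      rcases sX2 hx with h | h
      · exact sA h.1
      · exact sX h
    have sYS : Y' ⊆ S := fun x hx => by
      rcases sY2 hx with h | h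
      · exact sA h.1
      · exact sY h
    rcases split hB hb hX' hY' (Set.disjoint_left.2 dBX') (Set.disjoint_left.2 dBY')
      (Set.disjoint_left.2 d') (tBX.mono subset_rfl sX') (tBY.mono subset_rfl sY') with
      ⟨Z, sZ, hZ, tbZ, tZX, tZY⟩ | ⟨X2, Y2, tX', tY', tX2, tY2, hX2, hY2, d2, tbX, tbY⟩
    · refine h.2 (MD_K23_of hZ (CN_singleton G a) hX' hY' (CN_singleton G b)
        (fun x hx => sB (sZ hx).1) ?_ sXS sYS ?_ ?_ ?_ ?_ ?_ ?_ ?_ ?_ (Set.disjoint_left.2 d') ?_ ?_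
        tZX tZY tbZ.symm taX taY ⟨a, rfl, b, rfl, hab⟩)
      · simpa using sA ha
      · simpa using sB hb
      · exact Set.disjoint_singleton_right.2 fun hx => dAB ha (sZ hx).1
      · exact Set.disjoint_left.2 fun x hx => dBX' x (sZ hx).1
      · exact Set.disjoint_left.2 fun x hx => dBY' x (sZ hx).1
      · exact Set.disjoint_singleton_right.2 fun hx => (sZ hx).2 rfl
      · exact Set.disjoint_singleton_left.2 haX'
      · exact Set.disjoint_singleton_left.2 haY'
      · simpa using hab.ne
      · exact Set.disjoint_singleton_right.2 (dBX' b hb)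
      · exact Set.disjoint_singleton_right.2 (dBY' b hb)
    · refine good_core hab (sA ha) (sB hb) h hg hX2 hY2 ?_ ?_ d2 (taX.mono subset_rfl tX')
        (taY.mono subset_rfl tY') tbX tbY
      · intro x hx
        rcases tX2 hx with h | h
        · refine ⟨sB h.1, ?_⟩
          rintro (rfl | hh)
          · exact dAB ha h.1
          · exact h.2 hh
        · refine ⟨sXS h, ?_⟩
          rintro (rfl | hh)
          · exact haX' h
          · rw [Set.mem_singleton_iff] at hh
            subst hh
            exact dBX' _ hb h
      · intro x hx
        rcases tY2 hx with h | h
        · refine ⟨sB h.1, ?_⟩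
          rintro (rfl | hh)
          · exact dAB ha h.1
          · exact h.2 hh
        · refine ⟨sYS h, ?_⟩
          rintro (rfl | hh)
          · exact haY' h
          · rw [Set.mem_singleton_iff] at hh
            subst hh
            exact dBY' _ hb h

end helpers

section main

variable {V : Type*}

theorem compIn_sub_congr {G G' : SimpleGraph V} {T : Set V}
    (hs : ∀ x ∈ T, ∀ y ∈ T, G.Adj x y → G'.Adj x y) {p : V} (hp : p ∈ T) :
    compIn G T p ⊆ compIn G' T p :=
  CN_sub_cmp (CN_mono (cmp_CN hp) fun x hx y hy => hs x (cmp_sub hp hx) y (cmp_sub hp hy))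
    (cmp_sub hp) (self_cmp _ _ _) (self_cmp _ _ _)

theorem good_congr {G G' : SimpleGraph V} {S : Set V} {a b : V} (ha : a ∈ S) (hb : b ∈ S)
    (hs : ∀ x ∈ S, ∀ y ∈ S, G.Adj x y ↔ G'.Adj x y) (h : Good G S a b) : Good G' S a b := by
  have e : ∀ p ∈ S \ {a, b}, compIn G (S \ {a, b}) p = compIn G' (S \ {a, b}) p := fun p hp =>
    Set.Subset.antisymm
      (compIn_sub_congr (fun x hx y hy => (hs x hx.1 y hy.1).1) hp)
      (compIn_sub_congr (fun x hx y hy => (hs x hx.1 y hy.1).2) hp)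
  have tt : ∀ c ∈ S, ∀ p ∈ S \ {a, b}, Tch G' {c} (compIn G' (S \ {a, b}) p) →
      Tch G {c} (compIn G (S \ {a, b}) p) := by
    rintro c hc p hp ⟨x, hx, y, hy, hxy⟩
    rw [Set.mem_singleton_iff] at hx
    subst hx
    exact ⟨x, rfl, y, by rw [e p hp]; exact hy, (hs x hc y (cmp_sub hp hy).1).2 hxy⟩
  intro p hp q hq t1 t2 t3 t4
  rw [← e p hp]
  exact h p hp q hq (tt a ha p hp t1) (tt b hb p hp t2) (tt a ha q hq t3) (tt b hb q hq t4)

def addE (G : SimpleGraph V) (u v : V) : SimpleGraph V :=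
  G ⊔ SimpleGraph.fromEdgeSet {s(u, v)}

theorem addE_adj {G : SimpleGraph V} {u v : V} (huv : u ≠ v) {x y : V} :
    (addE G u v).Adj x y ↔ G.Adj x y ∨ (x = u ∧ y = v) ∨ (x = v ∧ y = u) := by
  unfold addE
  simp only [SimpleGraph.sup_adj, SimpleGraph.fromEdgeSet_adj, Set.mem_singleton_iff,
    Sym2.eq_iff]
  grind

theorem max_adj {G : SimpleGraph V} (h : MaximalOuterplanar G) {u v : V} (huv : u ≠ v)
    (ho : OP (addE G u v) Set.univ) : G.Adj u v := by
  by_contra hc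
  exact h.2 u v huv hc ((outerplanar_iff _).2 ho)

theorem two_nbrs [Finite V] {G : SimpleGraph V} (h : MaximalOuterplanar G)
    (hw : ∀ a b : V, ∃ w, w ≠ a ∧ w ≠ b) (v : V) :
    ∃ x y, x ≠ y ∧ G.Adj v x ∧ G.Adj v y := by
  by_contra hcon
  push Not at hcon
  have hG := (outerplanar_iff G).1 h.1
  have huniv : insert v ({v}ᶜ : Set V) = Set.univ := by
    ext x; simp [Classical.em]
  by_cases hv : ∃ a, G.Adj v a
  · obtain ⟨a, hva⟩ := hv
    have hN : ∀ x, G.Adj v x → x = a := fun x hx => by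
      by_contra hxa
      exact hcon x a hxa hx hva
    by_cases hb0 : ∃ b₀, b₀ ≠ v ∧ G.Adj a b₀
    · obtain ⟨b₀, hb₀, hab₀⟩ := hb0
      obtain ⟨b, hb, hab, hg⟩ := exists_good (S := {v}ᶜ) (by simpa using hb₀) hab₀
      have hbv : v ≠ b := fun h => hb h.symm
      have hag : ∀ x ∈ ({v}ᶜ : Set V), ∀ y ∈ ({v}ᶜ : Set V),
          G.Adj x y ↔ (addE G v b).Adj x y := by
        intro x hx y hy
        rw [addE_adj hbv]
        simp at hx hy
        grind
      have ho : OP (addE G v b) {v}ᶜ :=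
        OP_mono (fun x hx y hy => (hag x hx y hy).2) (Set.subset_univ _) hG
      have := OP_good (v := v) (a := a) (b := b) (by
        intro x hx hvx
        rw [addE_adj hbv] at hvx
        have := hN x
        grind) ((addE_adj hbv).2 (Or.inl hab)) ho
        (good_congr (by simpa using hva.ne') hb hag hg)
      rw [huniv] at this
      have hvb := max_adj h hbv this
      exact hab.ne (hN b hvb).symm
    · push Not at hb0
      obtain ⟨w, hwv, hwa⟩ := hw v a
      have hag : OP (addE G v w) {v, a}ᶜ := OP_mono (fun x hx y hy hxy => by
        rw [addE_adj hwv.symm] at hxy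
        simp at hx hy
        grind) (Set.subset_univ _) hG
      have h1 := OP_leaf (v := v) (a := w) (fun x hx hvx => by
        rw [addE_adj hwv.symm] at hvx
        simp at hx
        have := hN x
        grind) hag
      have h2 := OP_leaf (v := a) (a := v) (fun x hx hvx => by
        rw [addE_adj hwv.symm] at hvx
        have := hb0 x
        have := hva.ne
        grind) h1
      have hu : insert a (insert v ({v, a}ᶜ : Set V)) = Set.univ := by
        ext x; simp; tauto
      rw [hu] at h2
      exact hwa (hN w (max_adj h hwv.symm h2))
  · push Not at hv
    obtain ⟨w, hwv, -⟩ := hw v v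
    have ho : OP (addE G v w) {v}ᶜ := OP_mono (fun x hx y hy hxy => by
        rw [addE_adj hwv.symm] at hxy
        simp at hx hy
        grind) (Set.subset_univ _) hG
    have := OP_leaf (v := v) (a := w) (fun x hx hvx => by
      rw [addE_adj hwv.symm] at hvx
      have := hv x
      grind) ho
    rw [huniv] at this
    exact hv w (max_adj h hwv.symm this)

theorem nbrs_adj {G : SimpleGraph V} (h : MaximalOuterplanar G) {v a b : V} (hab : a ≠ b)
    (hva : G.Adj v a) (hvb : G.Adj v b) (hN : ∀ x, G.Adj v x → x = a ∨ x = b) : G.Adj a b := by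
  by_contra hnab
  have hG := (outerplanar_iff G).1 h.1
  have huniv : insert v ({v}ᶜ : Set V) = Set.univ := by
    ext x; simp [Classical.em]
  have key : ∀ {W : Type} (H : SimpleGraph W), MD (addE G a b) H {v}ᶜ → MD G H Set.univ := by
    rintro W H ⟨f, h1, h2, h3, h4⟩
    have hv : ∀ w, v ∉ f w := fun w hw => h2 w hw rfl
    refine ⟨fun w => f w ∪ {x | x = v ∧ a ∈ f w}, ?_, fun w => Set.subset_univ _, ?_, ?_⟩
    · intro w
      by_cases ha : a ∈ f w
      · refine ⟨⟨a, Or.inl ha⟩, ?_⟩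
        rintro A ⟨x, hx, hxA⟩ hc
        have hav : a ∈ A → v ∈ A := fun h => hc a (Or.inl ha) h v (Or.inr ⟨rfl, ha⟩) hva.symm
        have hva' : v ∈ A → a ∈ A := fun h => hc v (Or.inr ⟨rfl, ha⟩) h a (Or.inl ha) hva
        have hall := (h1 w).2 A (by
          rcases hx with hx | ⟨rfl, -⟩
          · exact ⟨x, hx, hxA⟩
          · exact ⟨a, ha, hva' hxA⟩) (by
          intro p hp hpA q hq hpq
          rw [addE_adj hab] at hpq
          rcases hpq with hpq | ⟨rfl, rfl⟩ | ⟨rfl, rfl⟩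
          · exact hc p (Or.inl hp) hpA q (Or.inl hq) hpq
          · exact hc v (Or.inr ⟨rfl, ha⟩) (hav hpA) q (Or.inl hq) hvb
          · exact hva' (hc p (Or.inl hp) hpA v (Or.inr ⟨rfl, ha⟩) hvb.symm))
        rintro y (hy | ⟨rfl, -⟩)
        · exact hall y hy
        · exact hav (hall a ha)
      · have : f w ∪ {x | x = v ∧ a ∈ f w} = f w := by
          ext x; simp [ha]
        simp only [this]
        refine CN_mono (h1 w) fun x hx y hy hxy => ?_
        rw [addE_adj hab] at hxy
        grind
    · rintro w w' hww x (hx | ⟨hxv, hx⟩) (hy | ⟨hyv, hy⟩)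
      · exact h3 w w' hww x hx hy
      · exact hv w (hyv ▸ hx)
      · exact hv w' (hxv ▸ hy)
      · exact h3 w w' hww a hx hy
    · intro w w' hww
      obtain ⟨p, hp, q, hq, hpq⟩ := h4 w w' hww
      rw [addE_adj hab] at hpq
      rcases hpq with hpq | ⟨rfl, rfl⟩ | ⟨rfl, rfl⟩
      · exact ⟨p, Or.inl hp, q, Or.inl hq, hpq⟩
      · exact ⟨v, Or.inr ⟨rfl, hp⟩, q, Or.inl hq, hvb⟩
      · exact ⟨p, Or.inl hp, v, Or.inr ⟨rfl, hq⟩, hvb.symm⟩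
  have ho : OP (addE G a b) {v}ᶜ := ⟨fun hm => hG.1 (key _ hm), fun hm => hG.2 (key _ hm)⟩
  have := OP_ear (v := v) (a := a) (b := b) (fun x hx hvx => by
    rw [addE_adj hab] at hvx
    have := hN x
    have := hva.ne
    have := hvb.ne
    grind) ((addE_adj hab).2 (Or.inr (Or.inl ⟨rfl, rfl⟩))) ho (by
    intro A B X Y hA hB hX hY sA sB sX sY dAB dAX dAY dBX dBY dXY tAX tAY tBX tBY ha hb
    have hbA : b ∉ A := fun h => Set.disjoint_left.1 dAB h hb
    have haB : a ∉ B := fun h => Set.disjoint_left.1 dAB ha h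
    have haX : a ∉ X := fun h => Set.disjoint_left.1 dAX ha h
    have haY : a ∉ Y := fun h => Set.disjoint_left.1 dAY ha h
    have hbX : b ∉ X := fun h => Set.disjoint_left.1 dBX hb h
    have hbY : b ∉ Y := fun h => Set.disjoint_left.1 dBY hb h
    have cn : ∀ T, CN (addE G a b) T → (a ∉ T ∨ b ∉ T) → CN G T := by
      intro T hT hab'
      refine CN_mono hT fun x hx y hy hxy => ?_
      rw [addE_adj hab] at hxy
      grind
    have tc : ∀ P Q, Tch (addE G a b) P Q → a ∉ Q → b ∉ Q → Tch G P Q := by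
      rintro P Q ⟨x, hx, y, hy, hxy⟩ h1 h2
      rw [addE_adj hab] at hxy
      exact ⟨x, hx, y, hy, by grind⟩
    refine hG.2 (MD_K23_of (cn A hA (Or.inr hbA)) (cn B hB (Or.inl haB)) (cn X hX (Or.inl haX))
      (cn Y hY (Or.inl haY)) (CN_singleton G v) (Set.subset_univ _) (Set.subset_univ _)
      (Set.subset_univ _) (Set.subset_univ _) (Set.subset_univ _) dAB dAX dAY ?_ dBX dBY ?_ dXY
      ?_ ?_ (tc _ _ tAX haX hbX) (tc _ _ tAY haY hbY) ⟨a, ha, v, rfl, hva.symm⟩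
      (tc _ _ tBX haX hbX) (tc _ _ tBY haY hbY) ⟨b, hb, v, rfl, hvb.symm⟩)
    · exact Set.disjoint_singleton_right.2 fun hx => sA hx rfl
    · exact Set.disjoint_singleton_right.2 fun hx => sB hx rfl
    · exact Set.disjoint_singleton_right.2 fun hx => sX hx rfl
    · exact Set.disjoint_singleton_right.2 fun hx => sY hx rfl)
  rw [huniv] at this
  exact hnab (max_adj h hab this)

theorem third_nbr [Finite V] {G : SimpleGraph V} (h : MaximalOuterplanar G)
    (hw : ∀ a b c : V, ∃ w, w ≠ a ∧ w ≠ b ∧ w ≠ c) {v a b : V} 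
    (hva : G.Adj v a) (hvb : G.Adj v b) (hab : G.Adj a b)
    (hN : ∀ x, G.Adj v x → x = a ∨ x = b) : ∃ x, G.Adj a x ∧ x ≠ v ∧ x ≠ b := by
  by_contra hcon
  push Not at hcon
  have hG := (outerplanar_iff G).1 h.1
  have n1 := hva.ne
  have n2 := hvb.ne
  have n3 := hab.ne
  by_cases hc0 : ∃ c₀ ∈ ({v, a}ᶜ : Set V), G.Adj b c₀
  · obtain ⟨c₀, hc₀, hbc₀⟩ := hc0
    obtain ⟨c, hc, hbc, hg⟩ := exists_good hc₀ hbc₀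
    have hvc : v ≠ c := by rintro rfl; simp at hc
    have hac : a ≠ c := by rintro rfl; simp at hc
    have n4 := hbc.ne
    have hag : ∀ x ∈ ({v, a}ᶜ : Set V), ∀ y ∈ ({v, a}ᶜ : Set V),
        G.Adj x y ↔ (addE G v c).Adj x y := by
      intro x hx y hy
      rw [addE_adj hvc]
      simp at hx hy
      grind
    have ho : OP (addE G v c) {v, a}ᶜ :=
      OP_mono (fun x hx y hy => (hag x hx y hy).2) (Set.subset_univ _) hG
    have h1 := OP_good (v := v) (a := b) (b := c) (by
      intro x hx hvx
      rw [addE_adj hvc] at hvx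
      simp at hx
      have := hN x
      grind) ((addE_adj hvc).2 (Or.inl hbc)) ho
      (good_congr (by simp; grind) hc hag hg)
    have h2 := OP_good (v := a) (a := v) (b := b) (by
      intro x hx hvx
      rw [addE_adj hvc] at hvx
      have := hcon x
      grind) ((addE_adj hvc).2 (Or.inl hvb)) h1
      (good_of_small (c := c) (by
        intro x hx hvx
        rw [addE_adj hvc] at hvx
        simp at hx
        have := hN x
        grind))
    have hu : insert a (insert v ({v, a}ᶜ : Set V)) = Set.univ := by
      ext x; simp; tauto
    rw [hu] at h2
    have := hN c (max_adj h hvc h2)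
    grind
  · push Not at hc0
    obtain ⟨w, hwv, hwa, hwb⟩ := hw v a b
    have ho : OP (addE G v w) {v, a, b}ᶜ := OP_mono (fun x hx y hy hxy => by
      rw [addE_adj hwv.symm] at hxy
      simp at hx hy
      grind) (Set.subset_univ _) hG
    have h1 := OP_leaf (v := v) (a := w) (fun x hx hvx => by
      rw [addE_adj hwv.symm] at hvx
      simp at hx
      have := hN x
      grind) ho
    have h2 := OP_leaf (v := b) (a := v) (fun x hx hvx => by
      rw [addE_adj hwv.symm] at hvx
      simp at hx
      have := hc0 x
      simp at this
      grind) h1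
    have h3 := OP_good (v := a) (a := v) (b := b) (by
      intro x hx hvx
      rw [addE_adj hwv.symm] at hvx
      have := hcon x
      grind) ((addE_adj hwv.symm).2 (Or.inl hvb)) h2
      (good_of_small (c := w) (by
        intro x hx hvx
        rw [addE_adj hwv.symm] at hvx
        simp at hx
        have := hN x
        grind))
    have hu : insert a (insert b (insert v ({v, a, b}ᶜ : Set V))) = Set.univ := by
      ext x; simp; tauto
    rw [hu] at h3
    have := hN w (max_adj h hwv.symm h3)
    grind

end main

/-- In a maximal outerplanar graph on `n ≥ 4` vertices, the
vertices of degree at least 3 form a double dominating set; hence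
`γ×2(G) ≤ n - t` where `t` is the number of degree-2 vertices. -/
theorem degree_ge_three_doubleDomSet {V : Type*} [Fintype V] [DecidableEq V]
    (G : SimpleGraph V) [DecidableRel G.Adj] (h : MaximalOuterplanar G)
    (hn : 4 ≤ Fintype.card V) :
    IsDoubleDomSet G (Finset.univ.filter fun v => 3 ≤ G.degree v) ∧
    doubleDomNum G ≤
      Fintype.card V - (Finset.univ.filter fun v => G.degree v = 2).card := by
  have hw3 : ∀ a b c : V, ∃ w, w ≠ a ∧ w ≠ b ∧ w ≠ c := by
    intro a b c
    have hc : ({a, b, c} : Finset V).card < Fintype.card V :=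
      lt_of_le_of_lt Finset.card_le_three (by omega)
    obtain ⟨w, hw⟩ := Finset.exists_mem_notMem_of_card_lt_card (s := {a, b, c})
      (t := Finset.univ) (by simpa [Finset.card_univ] using hc)
    exact ⟨w, by simpa using hw.2⟩
  have hdeg2 : ∀ v, 2 ≤ G.degree v := by
    intro v
    obtain ⟨x, y, hxy, hx, hy⟩ := two_nbrs h (fun a b => by
      obtain ⟨w, h1, h2, -⟩ := hw3 a b b
      exact ⟨w, h1, h2⟩) v
    rw [← G.card_neighborFinset_eq_degree v, ← Finset.card_pair hxy]
    apply Finset.card_le_card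
    intro z hz
    simp at hz
    rcases hz with rfl | rfl <;> simpa
  -- structure around a degree-2 vertex
  have hst : ∀ v, G.degree v = 2 → ∃ a b, a ≠ b ∧ G.Adj v a ∧ G.Adj v b ∧ G.Adj a b ∧
      (∀ x, G.Adj v x → x = a ∨ x = b) ∧ 3 ≤ G.degree a ∧ 3 ≤ G.degree b := by
    intro v hv
    rw [← G.card_neighborFinset_eq_degree v, Finset.card_eq_two] at hv
    obtain ⟨a, b, hab, he⟩ := hv
    have hN : ∀ x, G.Adj v x ↔ x = a ∨ x = b := fun x => by
      rw [← G.mem_neighborFinset, he]; simp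
    have hva := (hN a).2 (Or.inl rfl)
    have hvb := (hN b).2 (Or.inr rfl)
    have hadj := nbrs_adj h hab hva hvb fun x => (hN x).1
    have d3 : ∀ a b, G.Adj v a → G.Adj v b → G.Adj a b → (∀ x, G.Adj v x → x = a ∨ x = b) →
        3 ≤ G.degree a := by
      intro a b hva hvb hab hN
      obtain ⟨x, hax, hxv, hxb⟩ := third_nbr h hw3 hva hvb hab hN
      have hc : ({x, v, b} : Finset V).card = 3 := Finset.card_eq_three.2
        ⟨x, v, b, hxv, hxb, hvb.ne, rfl⟩
      rw [← G.card_neighborFinset_eq_degree a, ← hc]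
      apply Finset.card_le_card
      intro z hz
      simp at hz
      rcases hz with rfl | rfl | rfl
      · simpa
      · simpa using hva.symm
      · simpa
    exact ⟨a, b, hab, hva, hvb, hadj, fun x => (hN x).1,
      d3 a b hva hvb hadj fun x => (hN x).1,
      d3 b a hvb hva hadj.symm fun x hx => ((hN x).1 hx).symm⟩
  have hdd : IsDoubleDomSet G (Finset.univ.filter fun v => 3 ≤ G.degree v) := by
    intro v
    have pair : ∀ x y, x ≠ y → 3 ≤ G.degree x → 3 ≤ G.degree y → (x = v ∨ G.Adj v x) →
        (y = v ∨ G.Adj v y) → 2 ≤ ((Finset.univ.filter fun v => 3 ≤ G.degree v) ∩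
          insert v (G.neighborFinset v)).card := by
      intro x y hxy hx hy ax ay
      rw [← Finset.card_pair hxy]
      apply Finset.card_le_card
      intro z hz
      simp at hz
      rcases hz with rfl | rfl
      · simp [hx, ax]
      · simp [hy, ay]
    rcases (hdeg2 v).eq_or_lt with hv | hv
    · obtain ⟨a, b, hab, hva, hvb, -, -, ha, hb⟩ := hst v hv.symm
      exact pair a b hab ha hb (Or.inr hva) (Or.inr hvb)
    · have : 0 < (G.neighborFinset v).card := by
        rw [G.card_neighborFinset_eq_degree]; omega
      obtain ⟨u, hu⟩ := Finset.card_pos.1 this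
      rw [G.mem_neighborFinset] at hu
      rcases (hdeg2 u).eq_or_lt with hu2 | hu2
      · obtain ⟨a, b, hab, hua, hub, hadj, hN, ha, hb⟩ := hst u hu2.symm
        rcases hN v hu.symm with rfl | rfl
        · exact pair v b hab hv hb (Or.inl rfl) (Or.inr hadj)
        · exact pair v a hab.symm hv ha (Or.inl rfl) (Or.inr hadj.symm)
      · exact pair v u hu.ne hv hu2 (Or.inl rfl) (Or.inr hu)
  refine ⟨hdd, ?_⟩
  have hle : doubleDomNum G ≤ (Finset.univ.filter fun v => 3 ≤ G.degree v).card :=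
    Nat.sInf_le ⟨_, hdd, rfl⟩
  refine hle.trans ?_
  have hsum := Finset.card_filter_add_card_filter_not (s := (Finset.univ : Finset V))
    (fun v => G.degree v = 2)
  have he : (Finset.univ.filter fun v => ¬ G.degree v = 2) =
      Finset.univ.filter fun v => 3 ≤ G.degree v := by
    ext v
    have := hdeg2 v
    simp
    omega
  rw [he, Finset.card_univ] at hsum
  omega
end
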